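/- arXiv:1412.2075 — 6 statements merged into one kernel-verified Lean document; each statement's English description precedes it below -/
import Mathlib

section
/- Let α = (α₁,…,α_r) ∈ S^r, set m := n(α), and set k := #{σ ∈ S : σ(x) = x for every x ∉ N(α), and σ∘α_i = α_i∘σ for all 1 ≤ i ≤ r}. Then: (1) if n < m, no element of S_n^r is conjugate to α in S; (2) if n ≥ m, the set L_n of elements of S_n^r that are conjugate to α in S is nonempty, any two elements of L_n are conjugate by an element of S_n, and |L_n| = n·(n−1)⋯(n−m+1)/k. -/
lemma fh_ia (σ : Equiv.Perm ℕ+) (x : ℕ+) : σ⁻¹ (σ x) = x := σ.symm_apply_apply x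

lemma fh_ai (σ : Equiv.Perm ℕ+) (x : ℕ+) : σ (σ⁻¹ x) = x := σ.apply_symm_apply x

lemma fh_ext {s t : Finset ℕ+} (hst : s ⊆ t) (f : ℕ+ → ℕ+) (hf : Set.InjOn f s)
    (hm : ∀ x ∈ s, f x ∈ t) :
    ∃ σ : Equiv.Perm ℕ+, (∀ x, x ∉ t → σ x = x) ∧ ∀ x ∈ s, σ x = f x := by
  classical
  let g : {x : t // x.1 ∈ s} → t := fun x => ⟨f x.1.1, hm _ x.2⟩
  have hg : Function.Injective g := by
    intro x y h
    have h1 : f x.1.1 = f y.1.1 := congrArg Subtype.val h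
    exact Subtype.ext (Subtype.ext (hf x.2 y.2 h1))
  let e : {x : t // x.1 ∈ s} ≃ {y : t // y ∈ Set.range g} := Equiv.ofInjective g hg
  let τ : Equiv.Perm t := e.extendSubtype
  have hτ : ∀ x (hx : x ∈ s), (τ ⟨x, hst hx⟩ : ℕ+) = f x := by
    intro x hx
    have := Equiv.extendSubtype_apply_of_mem e ⟨x, hst hx⟩ hx
    exact congrArg Subtype.val this
  refine ⟨Equiv.Perm.ofSubtype (p := (· ∈ t)) τ, ?_, ?_⟩
  · intro x hx
    exact Equiv.Perm.ofSubtype_apply_of_not_mem τ hx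
  · intro x hx
    rw [Equiv.Perm.ofSubtype_apply_of_mem (p := (· ∈ t)) τ (hst hx)]
    exact hτ x hx

lemma fh_mem {r : ℕ} {α : Fin r → Equiv.Perm ℕ+} {x : ℕ+} (i : Fin r) (hx : α i x ≠ x) :
    ∃ j, α j (α i x) ≠ α i x := ⟨i, fun h => hx ((α i).injective h)⟩

lemma fh_agree {r : ℕ} (α : Fin r → Equiv.Perm ℕ+) (σ ρ : Equiv.Perm ℕ+)
    (h : ∀ x, (∃ i, α i x ≠ x) → σ x = ρ x) (i : Fin r) :
    σ * α i * σ⁻¹ = ρ * α i * ρ⁻¹ := by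
  have key : ∀ x, σ (α i x) = ρ (α i (ρ⁻¹ (σ x))) := by
    intro x
    by_cases hx : ∃ i, α i x ≠ x
    · rw [h x hx, fh_ia]
      by_cases h1 : α i x = x
      · rw [h1, h x hx]
      · exact h _ (fh_mem i h1)
    · have h2 : ¬ ∃ j, α j (ρ⁻¹ (σ x)) ≠ ρ⁻¹ (σ x) := by
        intro h3
        have h4 := h _ h3
        rw [fh_ai] at h4
        have h5 := σ.injective h4
        rw [h5] at h3
        exact hx h3
      push Not at hx h2
      rw [hx i, h2 i, fh_ai]
  ext y
  have := key (σ⁻¹ y)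
  rw [fh_ai] at this
  simp only [Equiv.Perm.mul_apply, this]

lemma fh_conj_mem {r : ℕ} {α β : Fin r → Equiv.Perm ℕ+} {σ : Equiv.Perm ℕ+}
    (h : ∀ i, β i = σ * α i * σ⁻¹) (x : ℕ+) :
    (∃ i, β i (σ x) ≠ σ x) ↔ ∃ i, α i x ≠ x := by
  simp [h]

lemma fh_ball (n : ℕ) : ∃ B : Finset ℕ+, B.card = n ∧ ∀ x : ℕ+, x ∈ B ↔ (x : ℕ) ≤ n := by
  refine ⟨(Finset.range n).map ⟨Nat.succPNat, Nat.succPNat_injective⟩, by simp, ?_⟩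
  intro x
  simp only [Finset.mem_map, Finset.mem_range, Function.Embedding.coeFn_mk]
  constructor
  · rintro ⟨a, ha, rfl⟩
    simpa using ha
  · intro hx
    have := x.pos
    exact ⟨x.natPred, by rw [PNat.natPred]; omega, by simp⟩

/-- **Farahat–Higman's lemma** on conjugacy classes of tuples of finitely supported
permutations of the positive integers: if `m = n(α)` is the number of points moved by the
tuple `α` and `k` the order of its "support-centralizer", then no tuple of `S_n^r` is
conjugate to `α` when `n < m`, and for `n ≥ m` the set `L_n` of tuples of `S_n^r` conjugate
to `α` in `S` is a nonempty `S_n`-conjugacy class of cardinality `n(n-1)⋯(n-m+1)/k`. -/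
theorem stmt12 (r : ℕ) (α : Fin r → Equiv.Perm ℕ+)
    (hα : ∀ i, {x : ℕ+ | α i x ≠ x}.Finite)
    (m k n : ℕ)
    (hm : m = Nat.card {x : ℕ+ // ∃ i, α i x ≠ x})
    (hk : k = Nat.card {σ : Equiv.Perm ℕ+ //
        (∀ x : ℕ+, (∀ i, α i x = x) → σ x = x) ∧ ∀ i, σ * α i = α i * σ}) :
    (n < m →
      ¬ ∃ β : Fin r → Equiv.Perm ℕ+,
          (∀ i, ∀ x : ℕ+, n < (x : ℕ) → β i x = x) ∧
          ∃ σ : Equiv.Perm ℕ+, {x : ℕ+ | σ x ≠ x}.Finite ∧ ∀ i, β i = σ * α i * σ⁻¹) ∧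
    (m ≤ n →
      (∃ β : Fin r → Equiv.Perm ℕ+,
          (∀ i, ∀ x : ℕ+, n < (x : ℕ) → β i x = x) ∧
          ∃ σ : Equiv.Perm ℕ+, {x : ℕ+ | σ x ≠ x}.Finite ∧ ∀ i, β i = σ * α i * σ⁻¹) ∧
      (∀ β γ : Fin r → Equiv.Perm ℕ+,
        ((∀ i, ∀ x : ℕ+, n < (x : ℕ) → β i x = x) ∧
          ∃ σ : Equiv.Perm ℕ+, {x : ℕ+ | σ x ≠ x}.Finite ∧ ∀ i, β i = σ * α i * σ⁻¹) →
        ((∀ i, ∀ x : ℕ+, n < (x : ℕ) → γ i x = x) ∧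
          ∃ σ : Equiv.Perm ℕ+, {x : ℕ+ | σ x ≠ x}.Finite ∧ ∀ i, γ i = σ * α i * σ⁻¹) →
        ∃ τ : Equiv.Perm ℕ+, (∀ x : ℕ+, n < (x : ℕ) → τ x = x) ∧
          ∀ i, γ i = τ * β i * τ⁻¹) ∧
      (Nat.card {β : Fin r → Equiv.Perm ℕ+ //
          (∀ i, ∀ x : ℕ+, n < (x : ℕ) → β i x = x) ∧
          ∃ σ : Equiv.Perm ℕ+, {x : ℕ+ | σ x ≠ x}.Finite ∧ ∀ i, β i = σ * α i * σ⁻¹} : ℚ) =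
        (∏ t ∈ Finset.range m, ((n : ℚ) - (t : ℚ))) / (k : ℚ)) := by
  classical
  have hfin : {x : ℕ+ | ∃ i, α i x ≠ x}.Finite := by
    have := Set.finite_iUnion hα
    refine this.subset ?_
    intro x hx
    simpa using hx
  obtain ⟨N, hN⟩ : ∃ N : Finset ℕ+, ∀ x, x ∈ N ↔ ∃ i, α i x ≠ x :=
    ⟨hfin.toFinset, by simp⟩
  have hmN : m = N.card := by
    rw [hm, ← Nat.card_eq_of_bijective _ (Equiv.subtypeEquivRight hN).bijective]
    simp
  obtain ⟨B, hBc, hB⟩ := fh_ball n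
  have hsub : ∀ β : Fin r → Equiv.Perm ℕ+, (∀ i, ∀ x : ℕ+, n < (x : ℕ) → β i x = x) →
      ∀ x, (∃ i, β i x ≠ x) → x ∈ B := by
    rintro β hβ x ⟨i, hi⟩
    rw [hB]
    by_contra hc
    exact hi (hβ i x (by omega))
  have himg : ∀ (β : Fin r → Equiv.Perm ℕ+) (σ : Equiv.Perm ℕ+),
      (∀ i, ∀ x : ℕ+, n < (x : ℕ) → β i x = x) → (∀ i, β i = σ * α i * σ⁻¹) →
      ∀ x ∈ N, σ x ∈ B := by
    intro β σ hβ hc x hx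
    exact hsub β hβ _ ((fh_conj_mem hc x).2 ((hN x).1 hx))
  have hmk : ∀ f : ℕ+ → ℕ+, Set.InjOn f N → (∀ x ∈ N, f x ∈ B) →
      ∃ σ : Equiv.Perm ℕ+, {x : ℕ+ | σ x ≠ x}.Finite ∧ (∀ x ∈ N, σ x = f x) ∧
        ∀ i, ∀ x : ℕ+, n < (x : ℕ) → (σ * α i * σ⁻¹) x = x := by
    intro f hf hfB
    obtain ⟨σ, h1, h2⟩ := fh_ext (s := N) (t := N ∪ B) Finset.subset_union_left f hf
      (fun x hx => Finset.mem_union_right _ (hfB x hx))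
    refine ⟨σ, (N ∪ B).finite_toSet.subset ?_, h2, ?_⟩
    · intro x hx
      by_contra hc
      exact hx (h1 x (by simpa using hc))
    · intro i x hx
      by_contra hc
      have h3 : σ⁻¹ x ∈ N := by
        rw [hN]
        refine ⟨i, fun h => hc ?_⟩
        simp only [Equiv.Perm.mul_apply, h, fh_ai]
      have h4 := hfB _ h3
      rw [← h2 _ h3, fh_ai, hB] at h4
      omega
  refine ⟨?_, fun hmn => ⟨?_, ?_, ?_⟩⟩
  · rintro hnm ⟨β, hβ, σ, -, hc⟩
    have := Finset.card_le_card_of_injOn σ (himg β σ hβ hc) σ.injective.injOn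
    omega
  · obtain ⟨g⟩ : Nonempty (N ↪ B) := by
      apply Function.Embedding.nonempty_of_card_le
      simp; omega
    obtain ⟨σ, h1, h2, h3⟩ := hmk (fun x => if h : x ∈ N then g ⟨x, h⟩ else x)
      (by
        intro x hx y hy h
        have hx' : x ∈ N := hx
        have hy' : y ∈ N := hy
        simp only [hx', hy', dif_pos] at h
        simpa using g.injective (Subtype.ext h))
      (by
        intro x hx
        simp [hx])
    exact ⟨fun i => σ * α i * σ⁻¹, h3, σ, h1, fun i => rfl⟩
  · rintro β γ ⟨hβ, σ, -, hσ⟩ ⟨hγ, ρ, -, hρ⟩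
    have hc : ∀ x, (∃ i, β i x ≠ x) → ρ (σ⁻¹ x) ∈ B := by
      intro x hx
      refine himg γ ρ hγ hρ _ ?_
      rw [hN, ← fh_conj_mem hσ, fh_ai]
      exact hx
    obtain ⟨τ, h1, h2⟩ := fh_ext (s := B.filter (fun x => ∃ i, β i x ≠ x)) (t := B)
      (Finset.filter_subset _ _) (ρ * σ⁻¹ : Equiv.Perm ℕ+) (ρ * σ⁻¹ : Equiv.Perm ℕ+).injective.injOn
      (fun x hx => hc x (Finset.mem_filter.1 hx).2)
    refine ⟨τ, fun x hx => h1 x (by rw [hB]; omega), fun i => ?_⟩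
    rw [fh_agree β τ (ρ * σ⁻¹)
      (fun x hx => h2 x (Finset.mem_filter.2 ⟨hsub β hβ x hx, hx⟩)) i, hρ, hσ]
    group
  · set L := {β : Fin r → Equiv.Perm ℕ+ //
          (∀ i, ∀ x : ℕ+, n < (x : ℕ) → β i x = x) ∧
          ∃ σ : Equiv.Perm ℕ+, {x : ℕ+ | σ x ≠ x}.Finite ∧ ∀ i, β i = σ * α i * σ⁻¹} with hL
    set C := {σ : Equiv.Perm ℕ+ //
        (∀ x : ℕ+, (∀ i, α i x = x) → σ x = x) ∧ ∀ i, σ * α i = α i * σ} with hC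
    have hs : ∀ β : L, ∃ σ : Equiv.Perm ℕ+, ∀ i, β.1 i = σ * α i * σ⁻¹ := by
      rintro ⟨β, h, σ, h1, h2⟩
      exact ⟨σ, h2⟩
    choose s hs using hs
    have hsc : ∀ (β : L) (c : C), ∀ i, β.1 i = (s β * c.1) * α i * (s β * c.1)⁻¹ := by
      intro β c i
      rw [mul_assoc (s β), c.2.2 i, hs β i]
      group
    let F : L × C → (N ↪ B) := fun p =>
      ⟨fun x => ⟨(s p.1 * p.2.1) x.1, himg p.1.1 _ p.1.2.1 (hsc p.1 p.2) x.1 x.2⟩, by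
        intro x y h
        have := congrArg Subtype.val h
        exact Subtype.ext ((s p.1 * p.2.1).injective this)⟩
    have hF : ∀ p x (hx : x ∈ N), (F p ⟨x, hx⟩ : ℕ+) = (s p.1 * p.2.1) x := fun p x hx => rfl
    have hFi : Function.Injective F := by
      rintro ⟨β, c⟩ ⟨β', c'⟩ h
      have hag : ∀ x ∈ N, (s β * c.1) x = (s β' * c'.1) x := by
        intro x hx
        rw [← hF (β, c) x hx, h, hF]
      have hb : β = β' := by
        apply Subtype.ext
        funext i
        rw [hsc β c i, hsc β' c' i]
        exact fh_agree α _ _ (fun x hx => hag x ((hN x).2 hx)) i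
      subst hb
      have hcc : c = c' := by
        apply Subtype.ext
        apply Equiv.ext
        intro x
        by_cases hx : x ∈ N
        · exact (s β).injective (hag x hx)
        · rw [hN] at hx
          push Not at hx
          rw [c.2.1 x hx, c'.2.1 x hx]
      rw [hcc]
    have hFs : Function.Surjective F := by
      intro g
      obtain ⟨σ, h1, h2, h3⟩ := hmk (fun x => if h : x ∈ N then g ⟨x, h⟩ else x)
        (by
          intro x hx y hy h
          have hx' : x ∈ N := hx
          have hy' : y ∈ N := hy
          simp only [hx', hy', dif_pos] at h
          simpa using g.injective (Subtype.ext h))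
        (by
          intro x hx
          simp [hx])
      let β : L := ⟨fun i => σ * α i * σ⁻¹, h3, σ, h1, fun i => rfl⟩
      have hβ : ∀ i, σ * α i * σ⁻¹ = s β * α i * (s β)⁻¹ := fun i => hs β i
      have hd : ∀ i, α i = ((s β)⁻¹ * σ) * α i * ((s β)⁻¹ * σ)⁻¹ := by
        intro i
        have : ((s β)⁻¹ * σ) * α i * ((s β)⁻¹ * σ)⁻¹ = (s β)⁻¹ * (σ * α i * σ⁻¹) * s β := by
          group
        rw [this, hβ i]
        group
      have hdN : ∀ x ∈ N, ((s β)⁻¹ * σ) x ∈ N := by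
        intro x hx
        rw [hN] at hx ⊢
        exact (fh_conj_mem hd x).2 hx
      obtain ⟨c, hc1, hc2⟩ := fh_ext (Finset.Subset.refl N) ((s β)⁻¹ * σ : Equiv.Perm ℕ+)
        ((s β)⁻¹ * σ : Equiv.Perm ℕ+).injective.injOn hdN
      have hcc : ∀ i, c * α i = α i * c := by
        intro i
        have := fh_agree α c ((s β)⁻¹ * σ) (fun x hx => hc2 x ((hN x).2 hx)) i
        rw [← hd i] at this
        exact mul_inv_eq_iff_eq_mul.1 this
      refine ⟨(β, ⟨c, fun x hx => hc1 x (by rw [hN]; push Not; exact hx), hcc⟩), ?_⟩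
      ext ⟨x, hx⟩
      rw [hF]
      have h4 := h2 x hx
      simp only [hx, dif_pos] at h4
      rw [← h4]
      simp only [Equiv.Perm.mul_apply]
      rw [hc2 x hx]
      simp
    have hcard : Nat.card L * k = n.descFactorial m := by
      rw [hk, ← Nat.card_prod, Nat.card_congr (Equiv.ofBijective F ⟨hFi, hFs⟩),
        Nat.card_eq_fintype_card, Fintype.card_embedding_eq]
      simp [hBc, hmN]
    have hpos : n.descFactorial m ≠ 0 := by
      rw [Ne, Nat.descFactorial_eq_zero_iff_lt]; omega
    have hk0 : (k : ℚ) ≠ 0 := by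
      intro h
      have : k = 0 := by exact_mod_cast h
      rw [← hcard, this] at hpos
      simp at hpos
    rw [eq_div_iff hk0]
    have : (∏ t ∈ Finset.range m, ((n : ℚ) - (t : ℚ))) = (n.descFactorial m : ℚ) := by
      rw [Nat.descFactorial_eq_prod_range, Nat.cast_prod]
      refine Finset.prod_congr rfl fun t ht => ?_
      rw [Nat.cast_sub]
      have := Finset.mem_range.1 ht
      omega
    rw [this, ← hcard]
    push_cast
    rfl
end

section
/- Let λ, δ, ρ be proper partitions. There exist nonnegative rational numbers a₀, a₁, …, a_{|λ|+|δ|−|ρ|}, independent of n (the list being empty when |ρ| > |λ|+|δ|, in which case the sum below is 0), such that for every integer n ≥ max(|λ|, |δ|, |ρ|) and every π ∈ S_{2n} with ct(π) = ρ̲ₙ: #{(σ,τ) ∈ K_{λ̲ₙ} × K_{δ̲ₙ} : σ·τ = π} = 2ⁿ·n!·Σ_{j=0}^{|λ|+|δ|−|ρ|} a_j·(n−|ρ|)·(n−|ρ|−1)⋯(n−|ρ|−j+1), where the j = 0 term of the sum is a₀. (The left-hand side is the structure coefficient α_{λδ}^{ρ}(n) of the Hecke algebra ℂ[B_n\S_{2n}/B_n]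 in the basis of double-coset sums K_{μ̲ₙ}.) -/
open scoped Classical

/-- The fixed-point-free involution `ε = (1 2)(3 4)⋯(2n-1 2n)` of `{1,…,2n}`
(in `Fin (2*n)`, zero-indexed: it exchanges `2k` and `2k+1`). -/
def epsilonPerm (n : ℕ) : Equiv.Perm (Fin (2 * n)) where
  toFun x := ⟨if x.1 % 2 = 0 then x.1 + 1 else x.1 - 1, by
    have h := x.2; split_ifs <;> omega⟩
  invFun x := ⟨if x.1 % 2 = 0 then x.1 + 1 else x.1 - 1, by
    have h := x.2; split_ifs <;> omega⟩
  left_inv := by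
    rintro ⟨v, hv⟩
    apply Fin.val_injective
    show (if (if v % 2 = 0 then v + 1 else v - 1) % 2 = 0
        then (if v % 2 = 0 then v + 1 else v - 1) + 1
        else (if v % 2 = 0 then v + 1 else v - 1) - 1) = v
    split_ifs <;> omega
  right_inv := by
    rintro ⟨v, hv⟩
    apply Fin.val_injective
    show (if (if v % 2 = 0 then v + 1 else v - 1) % 2 = 0
        then (if v % 2 = 0 then v + 1 else v - 1) + 1
        else (if v % 2 = 0 then v + 1 else v - 1) - 1) = v
    split_ifs <;> omega

/-- The coset type of a permutation `ω` of `2n`: the multiset of the halves of the sizes of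
the orbits of the subgroup generated by `ε` and `ω⁻¹ ∘ ε ∘ ω`. -/
noncomputable def cosetTypeCT (n : ℕ) (ω : Equiv.Perm (Fin (2 * n))) : Multiset ℕ :=
  letI : Fintype (MulAction.orbitRel.Quotient
      (Subgroup.closure {epsilonPerm n, ω⁻¹ * epsilonPerm n * ω}) (Fin (2 * n))) :=
    Fintype.ofFinite _
  (Finset.univ : Finset (MulAction.orbitRel.Quotient
      (Subgroup.closure {epsilonPerm n, ω⁻¹ * epsilonPerm n * ω}) (Fin (2 * n)))).val.map
    (fun o => Nat.card o.orbit / 2)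


/-- Fixed-point-free involution. -/
def FpI {X : Type} (e : X → X) : Prop := (∀ x, e (e x) = x) ∧ ∀ x, e x ≠ x

/-- Half-size of the orbit of `x` under the two involutions. -/
noncomputable def mpd {X : Type} (e m : X → X) (x : X) : ℕ :=
  Function.minimalPeriod (fun x => e (m x)) x

/-- The pair `(e,m)` has non-trivial type `l`. -/
def HTy {X : Type} (e m : X → X) (l : Multiset ℕ) : Prop :=
  ∀ k, 2 ≤ k → Nat.card {x // mpd e m x = k} = 2 * k * l.count k

/-- Enumeration of an orbit. -/
def orbEnum {X : Type} (e m : X → X) (x : X) (a : ℕ × Bool) : X :=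
  match a.2 with
  | false => (fun x => e (m x))^[a.1] x
  | true => e ((fun x => e (m x))^[a.1] x)

section basics
variable {X : Type} {e m : X → X}

theorem FpI.inj (he : FpI e) : Function.Injective e := fun a b h => by
  rw [← he.1 a, h, he.1 b]

theorem rinj (he : FpI e) (hm : FpI m) : Function.Injective (fun x => e (m x)) :=
  fun _ _ h => hm.inj (he.inj h)

theorem mpd_pos [Finite X] (he : FpI e) (hm : FpI m) (x : X) : 0 < mpd e m x :=
  Function.minimalPeriod_pos_of_mem_periodicPts ((rinj he hm).mem_periodicPts x)

theorem mpd_eq_one (he : FpI e) (x : X) : mpd e m x = 1 ↔ e x = m x := by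
  unfold mpd
  rw [Function.minimalPeriod_eq_one_iff_isFixedPt]
  unfold Function.IsFixedPt
  constructor
  · intro h
    have := congrArg e h
    rw [he.1] at this
    exact this.symm
  · intro h
    show e (m x) = x
    rw [← h, he.1]

theorem iter_ne (he : FpI e) (hm : FpI m) (l : ℕ) :
    ∀ x, (fun x => e (m x))^[l] x ≠ e x := by
  induction l using Nat.twoStepInduction with
  | zero => intro x h; exact he.2 x h.symm
  | one => intro x h; exact hm.2 x (he.inj h)
  | more l ih _ =>
    intro x h
    apply ih (e (m x))
    apply rinj he hm
    show _ = e (m (e (e (m x))))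
    rw [he.1, hm.1, ← h]
    exact (Function.iterate_succ_apply' (fun x => e (m x)) l (e (m x))).symm

theorem iter_e (he : FpI e) (hm : FpI m) (j : ℕ) :
    ∀ x, (fun x => e (m x))^[j] (e ((fun x => e (m x))^[j] x)) = e x := by
  induction j with
  | zero => intro x; rfl
  | succ j ih =>
    intro x
    rw [Function.iterate_succ_apply, Function.iterate_succ_apply']
    rw [show e (m (e (e (m ((fun x => e (m x))^[j] x))))) = e ((fun x => e (m x))^[j] x) by
      rw [he.1, hm.1]]
    exact ih x

theorem iter_ne2 (he : FpI e) (hm : FpI m) (i j : ℕ) (x : X) :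
    (fun x => e (m x))^[i] x ≠ e ((fun x => e (m x))^[j] x) := by
  intro h
  have := iter_e he hm j x
  rw [← h, ← Function.iterate_add_apply] at this
  exact iter_ne he hm _ _ this

theorem iter_eq_iff [Finite X] (he : FpI e) (hm : FpI m) (i j : ℕ) (x : X) :
    (fun x => e (m x))^[i] x = (fun x => e (m x))^[j] x ↔ i % mpd e m x = j % mpd e m x := by
  have hp := mpd_pos he hm x
  unfold mpd at *
  rw [← Function.iterate_mod_minimalPeriod_eq (n := i),
    ← Function.iterate_mod_minimalPeriod_eq (n := j)]
  rw [Function.iterate_eq_iterate_iff_of_lt_minimalPeriod (Nat.mod_lt _ hp) (Nat.mod_lt _ hp)]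

theorem orbEnum_eq_iff [Finite X] (he : FpI e) (hm : FpI m) (x : X) (a b : ℕ × Bool) :
    orbEnum e m x a = orbEnum e m x b ↔ a.2 = b.2 ∧ a.1 % mpd e m x = b.1 % mpd e m x := by
  obtain ⟨i, s⟩ := a
  obtain ⟨j, t⟩ := b
  cases s <;> cases t <;> simp only [orbEnum]
  · simpa using iter_eq_iff he hm i j x
  · simpa using iter_ne2 he hm i j x
  · simpa using (iter_ne2 he hm j i x).symm
  · rw [he.inj.eq_iff]
    simpa using iter_eq_iff he hm i j x

theorem orbEnum_e (he : FpI e) (x : X) (i : ℕ) (b : Bool) :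
    e (orbEnum e m x (i, b)) = orbEnum e m x (i, !b) := by
  cases b <;> simp [orbEnum, he.1]

theorem orbEnum_m_false (he : FpI e) (x : X) (i : ℕ) :
    m (orbEnum e m x (i, false)) = orbEnum e m x (i + 1, true) := by
  simp only [orbEnum]
  rw [Function.iterate_succ_apply', he.1]

theorem orbEnum_m_true [Finite X] (he : FpI e) (hm : FpI m) (x : X) (i : ℕ) :
    m (orbEnum e m x (i, true)) = orbEnum e m x (i + (mpd e m x - 1), false) := by
  have hp := mpd_pos he hm x
  apply hm.inj
  rw [orbEnum_m_false (m := m) he, hm.1, orbEnum_eq_iff he hm]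
  refine ⟨rfl, ?_⟩
  show i % _ = (i + (mpd e m x - 1) + 1) % _
  rw [show i + (mpd e m x - 1) + 1 = i + mpd e m x by omega, Nat.add_mod_right]

theorem orbEnum_zero (x : X) : orbEnum e m x (0, false) = x := rfl

theorem card_range_orbEnum [Finite X] (he : FpI e) (hm : FpI m) (x : X) :
    Nat.card (Set.range (orbEnum e m x)) = 2 * mpd e m x := by
  have hp := mpd_pos he hm x
  have h1 : Set.range (orbEnum e m x) =
      Set.range (fun a : Fin (mpd e m x) × Bool => orbEnum e m x (a.1.1, a.2)) := by
    ext y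
    constructor
    · rintro ⟨⟨i, b⟩, rfl⟩
      refine ⟨(⟨i % mpd e m x, Nat.mod_lt _ hp⟩, b), ?_⟩
      show orbEnum e m x (i % mpd e m x, b) = _
      rw [orbEnum_eq_iff he hm]
      simp
    · rintro ⟨a, rfl⟩
      exact ⟨_, rfl⟩
  rw [h1]
  have hinj : Function.Injective
      (fun a : Fin (mpd e m x) × Bool => orbEnum e m x (a.1.1, a.2)) := by
    rintro ⟨i, b⟩ ⟨j, c⟩ h
    have h' := (orbEnum_eq_iff he hm x _ _).1 h
    simp only [Nat.mod_eq_of_lt i.2, Nat.mod_eq_of_lt j.2] at h'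
    rw [h'.1, Fin.ext h'.2]
  rw [← Nat.card_congr (Equiv.ofInjective _ hinj)]
  simp [mul_comm]

end basics

section groups
variable {X : Type}

theorem orbit_closure [Finite X] (e m : Equiv.Perm X) (he : FpI e) (hm : FpI m) (x : X) :
    MulAction.orbit (Subgroup.closure {e, m}) x = Set.range (orbEnum e m x) := by
  have cle : ∀ y, y ∈ Set.range (orbEnum e m x) → e y ∈ Set.range (orbEnum e m x) := by
    rintro _ ⟨⟨i, b⟩, rfl⟩
    exact ⟨_, (orbEnum_e he x i b).symm⟩
  have clm : ∀ y, y ∈ Set.range (orbEnum e m x) → m y ∈ Set.range (orbEnum e m x) := by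
    rintro _ ⟨⟨i, b⟩, rfl⟩
    cases b
    · exact ⟨_, (orbEnum_m_false he x i).symm⟩
    · exact ⟨_, (orbEnum_m_true he hm x i).symm⟩
  have key : ∀ g ∈ Subgroup.closure {e, m}, ∀ y,
      y ∈ Set.range (orbEnum e m x) ↔ g y ∈ Set.range (orbEnum e m x) := by
    intro g hg
    induction hg using Subgroup.closure_induction with
    | mem g hg =>
      intro y
      rcases hg with rfl | rfl
      · exact ⟨cle y, fun h => by have := cle _ h; rwa [he.1] at this⟩
      · exact ⟨clm y, fun h => by have := clm _ h; rwa [hm.1] at this⟩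
    | one => intro y; rfl
    | mul a b _ _ ha hb => intro y; rw [hb y, ha]; rfl
    | inv a _ ha => intro y; rw [ha (a⁻¹ y)]; simp
  have he' : e ∈ Subgroup.closure {e, m} := Subgroup.subset_closure (by simp)
  have hm' : m ∈ Subgroup.closure {e, m} := Subgroup.subset_closure (by simp)
  have hit : ∀ i : ℕ, (fun x => e (m x))^[i] x ∈ MulAction.orbit (Subgroup.closure {e, m}) x := by
    intro i
    induction i with
    | zero => exact MulAction.mem_orbit_self x
    | succ i ih =>
      rw [Function.iterate_succ_apply']
      exact MulAction.mem_orbit_of_mem_orbit (⟨e * m, mul_mem he' hm'⟩ : Subgroup.closure {e, m}) ih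
  apply Set.Subset.antisymm
  · rintro _ ⟨g, rfl⟩
    exact (key g.1 g.2 x).1 ⟨(0, false), rfl⟩
  · rintro _ ⟨⟨i, b⟩, rfl⟩
    cases b
    · exact hit i
    · exact MulAction.mem_orbit_of_mem_orbit (⟨e, he'⟩ : Subgroup.closure {e, m}) (hit i)

theorem card_orbit_closure [Finite X] (e m : Equiv.Perm X) (he : FpI e) (hm : FpI m) (x : X) :
    Nat.card (MulAction.orbit (Subgroup.closure {e, m}) x) = 2 * mpd e m x := by
  rw [orbit_closure e m he hm, card_range_orbEnum he hm]

theorem card_quot_orbit [Finite X] (e m : Equiv.Perm X) (he : FpI e) (hm : FpI m) (x : X) :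
    Nat.card (MulAction.orbitRel.Quotient.orbit (Quotient.mk'' x :
      MulAction.orbitRel.Quotient (Subgroup.closure {e, m}) X)) = 2 * mpd e m x := by
  rw [MulAction.orbitRel.Quotient.orbit_mk, card_orbit_closure e m he hm]

theorem card_mpd_eq [Finite X] (e m : Equiv.Perm X) (he : FpI e) (hm : FpI m) (k : ℕ) :
    Nat.card {x // mpd e m x = k} =
      2 * k * Nat.card {q : MulAction.orbitRel.Quotient (Subgroup.closure {e, m}) X //
        Nat.card q.orbit / 2 = k} := by
  let _ : Fintype {q : MulAction.orbitRel.Quotient (Subgroup.closure {e, m}) X //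
        Nat.card q.orbit / 2 = k} := Fintype.ofFinite _
  have E : {x // mpd e m x = k} ≃
      Σ q : {q : MulAction.orbitRel.Quotient (Subgroup.closure {e, m}) X //
        Nat.card q.orbit / 2 = k}, q.1.orbit := by
    refine
      { toFun := fun x => ⟨⟨Quotient.mk'' x.1, ?_⟩, ⟨x.1, ?_⟩⟩
        invFun := fun s => ⟨s.2.1, ?_⟩
        left_inv := ?_
        right_inv := ?_ }
    · rw [card_quot_orbit e m he hm, x.2]; omega
    · rw [MulAction.orbitRel.Quotient.orbit_mk]; exact MulAction.mem_orbit_self _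
    · have h1 := s.1.2
      have h2 := s.2.2
      rw [MulAction.orbitRel.Quotient.mem_orbit] at h2
      rw [← h2, card_quot_orbit e m he hm] at h1
      omega
    · intro x; rfl
    · rintro ⟨⟨q, hq⟩, ⟨y, hy⟩⟩
      have h2 := hy
      rw [MulAction.orbitRel.Quotient.mem_orbit] at h2
      subst h2
      rfl
  rw [Nat.card_congr E, Nat.card_sigma]
  have : ∀ q : {q : MulAction.orbitRel.Quotient (Subgroup.closure {e, m}) X //
        Nat.card q.orbit / 2 = k}, Nat.card q.1.orbit = 2 * k := by
    rintro ⟨q, hq⟩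
    induction q using Quotient.inductionOn' with
    | h x =>
      show Nat.card (MulAction.orbitRel.Quotient.orbit (Quotient.mk'' x :
        MulAction.orbitRel.Quotient (Subgroup.closure {e, m}) X)) = _
      rw [card_quot_orbit e m he hm] at hq ⊢
      omega
  simp only [this]
  rw [Finset.sum_const, Finset.card_univ, Nat.card_eq_fintype_card, smul_eq_mul, mul_comm]

end groups

section classify

theorem card_ne_eq {X : Type} [Finite X] {e m : X → X} (he : FpI e) (hm : FpI m)
    {l : Multiset ℕ} (hl : ∀ p ∈ l, 2 ≤ p) (h : HTy e m l) :
    Nat.card {x // e x ≠ m x} = 2 * l.sum := by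
  cases nonempty_fintype X
  rw [Nat.card_eq_fintype_card, Fintype.card_subtype]
  have key : ∀ k, 2 ≤ k → (Finset.univ.filter (fun x => mpd e m x = k)).card
      = 2 * k * l.count k := by
    intro k hk
    rw [← h k hk, Nat.card_eq_fintype_card, Fintype.card_subtype]
  have hge : ∀ x, e x ≠ m x → 2 ≤ mpd e m x := by
    intro x hx
    have h1 := mpd_pos he hm x
    have h2 : mpd e m x ≠ 1 := fun h => hx ((mpd_eq_one he x).1 h)
    omega
  rw [Finset.card_eq_sum_card_fiberwise (f := mpd e m) (t := l.toFinset)]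
  · rw [Finset.sum_multiset_count, Finset.mul_sum]
    refine Finset.sum_congr rfl fun k hk => ?_
    have hk2 := hl k (Multiset.mem_toFinset.1 hk)
    rw [Finset.filter_filter, smul_eq_mul, show 2 * (l.count k * k) = 2 * k * l.count k by ring,
      ← key k hk2]
    congr 1
    ext x
    simp only [Finset.mem_filter, Finset.mem_univ, true_and, and_iff_right_iff_imp]
    intro hx hx'
    rw [(mpd_eq_one he x).2 hx'] at hx
    omega
  · intro x hx
    have hx' : e x ≠ m x := by simpa using hx
    have h2 := key _ (hge x hx')
    have h3 : 0 < (Finset.univ.filter (fun y => mpd e m y = mpd e m x)).card :=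
      Finset.card_pos.2 ⟨x, by simp⟩
    have : 0 < l.count (mpd e m x) := by
      by_contra h0
      have : l.count (mpd e m x) = 0 := by omega
      rw [this] at h2
      omega
    simpa using Multiset.count_pos.1 this

theorem card_eq_add_ne {X : Type} [Finite X] {e m : X → X} (he : FpI e) (hm : FpI m)
    {l : Multiset ℕ} (hl : ∀ p ∈ l, 2 ≤ p) (h : HTy e m l) :
    Nat.card X = Nat.card {x // mpd e m x = 1} + 2 * l.sum := by
  rw [← card_ne_eq he hm hl h, ← Nat.card_congr (Equiv.sumCompl (fun x => mpd e m x = 1)),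
    Nat.card_sum]
  congr 1
  exact Nat.card_congr (Equiv.subtypeEquivRight fun x => by
    show ¬ _ ↔ _
    rw [mpd_eq_one he])

theorem mk_eq_left {X : Type} (e m : Equiv.Perm X) (x : X) :
    (Quotient.mk'' (e x) : MulAction.orbitRel.Quotient (Subgroup.closure {e, m}) X)
      = Quotient.mk'' x :=
  Quotient.sound' ⟨(⟨e, Subgroup.subset_closure (by simp)⟩ : Subgroup.closure {e, m}), rfl⟩

theorem mk_eq_right {X : Type} (e m : Equiv.Perm X) (x : X) :
    (Quotient.mk'' (m x) : MulAction.orbitRel.Quotient (Subgroup.closure {e, m}) X)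
      = Quotient.mk'' x :=
  Quotient.sound' ⟨(⟨m, Subgroup.subset_closure (by simp)⟩ : Subgroup.closure {e, m}), rfl⟩

theorem orb_zero_quot {X : Type} [Finite X] (e m : Equiv.Perm X) (he : FpI e) (hm : FpI m)
    (q : MulAction.orbitRel.Quotient (Subgroup.closure {e, m}) X) :
    0 < Nat.card q.orbit / 2 := by
  induction q using Quotient.inductionOn' with
  | h x =>
    have := mpd_pos he hm x
    show 0 < Nat.card (MulAction.orbitRel.Quotient.orbit (Quotient.mk'' x :
        MulAction.orbitRel.Quotient (Subgroup.closure {e, m}) X)) / 2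
    rw [card_quot_orbit e m he hm]
    omega

theorem classify_perm {X Y : Type} [Finite X] [Finite Y] (e m : Equiv.Perm X) (f h : Equiv.Perm Y)
    (he : FpI e) (hm : FpI m) (hf : FpI f) (hh : FpI h)
    {l : Multiset ℕ} (hl : ∀ p ∈ l, 2 ≤ p) (h1 : HTy e m l) (h2 : HTy f h l)
    (hc : Nat.card X = Nat.card Y) :
    ∃ H : X ≃ Y, (∀ x, H (e x) = f (H x)) ∧ ∀ x, H (m x) = h (H x) := by
  have cnt : ∀ k, Nat.card {x // mpd e m x = k} = Nat.card {y // mpd f h y = k} := by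
    intro k
    rcases Nat.lt_or_ge k 2 with hk | hk
    · interval_cases k
      · have : IsEmpty {x // mpd e m x = 0} := ⟨fun x => (mpd_pos he hm x.1).ne' x.2⟩
        have : IsEmpty {x // mpd f h x = 0} := ⟨fun x => (mpd_pos hf hh x.1).ne' x.2⟩
        simp
      · have a := card_eq_add_ne he hm hl h1
        have b := card_eq_add_ne hf hh hl h2
        omega
    · rw [h1 k hk, h2 k hk]
  have qc : ∀ k, Nat.card {q : MulAction.orbitRel.Quotient (Subgroup.closure {e, m}) X //
        Nat.card q.orbit / 2 = k} = Nat.card {q : MulAction.orbitRel.Quotient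
        (Subgroup.closure {f, h}) Y // Nat.card q.orbit / 2 = k} := by
    intro k
    rcases Nat.eq_zero_or_pos k with rfl | hk
    · have : IsEmpty {q : MulAction.orbitRel.Quotient (Subgroup.closure {e, m}) X //
        Nat.card q.orbit / 2 = 0} := ⟨fun q => (orb_zero_quot e m he hm q.1).ne' q.2⟩
      have : IsEmpty {q : MulAction.orbitRel.Quotient (Subgroup.closure {f, h}) Y //
        Nat.card q.orbit / 2 = 0} := ⟨fun q => (orb_zero_quot f h hf hh q.1).ne' q.2⟩
      simp only [Nat.card_of_isEmpty]
    · have := cnt k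
      rw [card_mpd_eq e m he hm, card_mpd_eq f h hf hh] at this
      exact Nat.eq_of_mul_eq_mul_left (by omega) this
  obtain ⟨E, hE⟩ : ∃ E : MulAction.orbitRel.Quotient (Subgroup.closure {e, m}) X ≃
      MulAction.orbitRel.Quotient (Subgroup.closure {f, h}) Y,
      ∀ q, Nat.card (E q).orbit / 2 = Nat.card q.orbit / 2 :=
    ⟨Equiv.ofFiberEquiv (fun k => Classical.choice ((Finite.card_eq).1 (qc k))),
      fun q => Equiv.ofFiberEquiv_map (f := fun q : MulAction.orbitRel.Quotient
        (Subgroup.closure {e, m}) X => Nat.card q.orbit / 2)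
        (g := fun q : MulAction.orbitRel.Quotient
        (Subgroup.closure {f, h}) Y => Nat.card q.orbit / 2) _ q⟩
  have mkE : ∀ x : X, ∃ y : Y, (Quotient.mk'' y : MulAction.orbitRel.Quotient
      (Subgroup.closure {f, h}) Y) = E (Quotient.mk'' x) ∧ mpd f h y = mpd e m x := by
    intro x
    obtain ⟨y, hy⟩ := Quotient.exists_rep (E (Quotient.mk'' x))
    refine ⟨y, hy, ?_⟩
    have hq := hE (Quotient.mk'' x)
    rw [← hy] at hq
    change Nat.card (MulAction.orbitRel.Quotient.orbit (Quotient.mk'' y :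
        MulAction.orbitRel.Quotient (Subgroup.closure {f, h}) Y)) / 2 = _ at hq
    rw [card_quot_orbit e m he hm, card_quot_orbit f h hf hh] at hq
    omega
  have hex : ∀ q : MulAction.orbitRel.Quotient (Subgroup.closure {e, m}) X,
      ∃ (x : X) (y : Y), (Quotient.mk'' x = q) ∧
        (Quotient.mk'' y : MulAction.orbitRel.Quotient (Subgroup.closure {f, h}) Y) = E q ∧
        mpd f h y = mpd e m x := by
    intro q
    obtain ⟨x, rfl⟩ := Quotient.exists_rep q
    obtain ⟨y, hy⟩ := mkE x
    exact ⟨x, y, rfl, hy⟩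
  choose x0 y0 hx0 hy0 hxy using hex
  let Hq : MulAction.orbitRel.Quotient (Subgroup.closure {e, m}) X → X → Y := fun q =>
    Function.extend (orbEnum e m (x0 q)) (orbEnum f h (y0 q)) (fun _ => y0 q)
  have HqE : ∀ q a, Hq q (orbEnum e m (x0 q) a) = orbEnum f h (y0 q) a := by
    intro q a
    apply Function.FactorsThrough.extend_apply
    intro b c hbc
    rw [orbEnum_eq_iff he hm] at hbc
    rw [orbEnum_eq_iff hf hh, hxy]
    exact hbc
  let H : X → Y := fun x => Hq (Quotient.mk'' x) x
  have rep : ∀ x q, q = (Quotient.mk'' x : MulAction.orbitRel.Quotient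
      (Subgroup.closure {e, m}) X) → ∃ i b, x = orbEnum e m (x0 q) (i, b) := by
    intro x q hq
    have : x ∈ MulAction.orbit (Subgroup.closure {e, m}) (x0 q) :=
      Quotient.exact' (hq.symm.trans (hx0 q).symm)
    rw [orbit_closure e m he hm] at this
    obtain ⟨⟨i, b⟩, h⟩ := this
    exact ⟨i, b, h.symm⟩
  have mkY : ∀ q a, (Quotient.mk'' (orbEnum f h (y0 q) a) :
      MulAction.orbitRel.Quotient (Subgroup.closure {f, h}) Y) = E q := by
    intro q a
    rw [← hy0 q]
    apply Quotient.sound'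
    show _ ∈ MulAction.orbit (Subgroup.closure {f, h}) (y0 q)
    rw [orbit_closure f h hf hh]
    exact ⟨a, rfl⟩
  have Hinj : Function.Injective H := by
    intro x x' hxx
    obtain ⟨i, b, h1⟩ := rep x _ rfl
    obtain ⟨j, c, h2⟩ := rep x' _ rfl
    have e1 : H x = orbEnum f h (y0 (Quotient.mk'' x)) (i, b) := by
      show Hq (Quotient.mk'' x) x = _
      conv_lhs => rw [h1]
      rw [← h1, ← HqE, ← h1]
    have e2 : H x' = orbEnum f h (y0 (Quotient.mk'' x')) (j, c) := by
      show Hq (Quotient.mk'' x') x' = _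
      rw [← HqE, ← h2]
    have hq : (Quotient.mk'' x : MulAction.orbitRel.Quotient (Subgroup.closure {e, m}) X)
        = Quotient.mk'' x' := by
      apply E.injective
      rw [← mkY _ (i, b), ← mkY _ (j, c), ← e1, ← e2, hxx]
    rw [e1, e2, hq, orbEnum_eq_iff hf hh, hxy] at hxx
    rw [h1, h2, hq, orbEnum_eq_iff he hm]
    exact hxx
  have Hbij : Function.Bijective H := by
    cases nonempty_fintype X
    cases nonempty_fintype Y
    rw [Fintype.bijective_iff_injective_and_card]
    refine ⟨Hinj, ?_⟩
    rwa [Nat.card_eq_fintype_card, Nat.card_eq_fintype_card] at hc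
  refine ⟨Equiv.ofBijective H Hbij, ?_, ?_⟩
  · intro x
    show Hq (Quotient.mk'' (e x)) (e x) = f (Hq (Quotient.mk'' x) x)
    rw [mk_eq_left]
    obtain ⟨i, b, h1⟩ := rep x _ rfl
    generalize (Quotient.mk'' x : MulAction.orbitRel.Quotient
      (Subgroup.closure {e, m}) X) = q at h1 ⊢
    rw [h1, orbEnum_e he, HqE, HqE, orbEnum_e hf]
  · intro x
    show Hq (Quotient.mk'' (m x)) (m x) = h (Hq (Quotient.mk'' x) x)
    rw [mk_eq_right]
    obtain ⟨i, b, h1⟩ := rep x _ rfl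
    generalize (Quotient.mk'' x : MulAction.orbitRel.Quotient
      (Subgroup.closure {e, m}) X) = q at h1 ⊢
    rw [h1]
    cases b
    · rw [orbEnum_m_false (m := m) he, HqE, HqE, orbEnum_m_false (m := h) hf]
    · rw [orbEnum_m_true he hm, HqE, HqE, orbEnum_m_true hf hh, hxy]

theorem classify {X Y : Type} [Finite X] [Finite Y] {e m : X → X} {f h : Y → Y}
    (he : FpI e) (hm : FpI m) (hf : FpI f) (hh : FpI h)
    {l : Multiset ℕ} (hl : ∀ p ∈ l, 2 ≤ p) (h1 : HTy e m l) (h2 : HTy f h l)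
    (hc : Nat.card X = Nat.card Y) :
    ∃ H : X ≃ Y, (∀ x, H (e x) = f (H x)) ∧ ∀ x, H (m x) = h (H x) :=
  classify_perm (Function.Involutive.toPerm e he.1) (Function.Involutive.toPerm m hm.1)
    (Function.Involutive.toPerm f hf.1) (Function.Involutive.toPerm h hh.1) he hm hf hh hl h1 h2 hc

end classify

section bridge

theorem eps_fpI (n : ℕ) : FpI (epsilonPerm n) := by
  constructor
  · intro x
    exact (epsilonPerm n).left_inv x
  · intro x h
    have := congrArg Fin.val h
    change (if x.1 % 2 = 0 then x.1 + 1 else x.1 - 1) = x.1 at this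
    split_ifs at this <;> omega

theorem conj_fpI {X : Type} (e w : Equiv.Perm X) (he : FpI e) :
    FpI (w⁻¹ * e * w : Equiv.Perm X) := by
  constructor
  · intro x
    simp [he.1]
  · intro x h
    apply he.2 (w x)
    have h' : w⁻¹ (e (w x)) = x := h
    rwa [Equiv.Perm.inv_eq_iff_eq] at h'

theorem count_ct (n : ℕ) (ω : Equiv.Perm (Fin (2 * n))) (k : ℕ) :
    Nat.card {x // mpd (epsilonPerm n) (ω⁻¹ * epsilonPerm n * ω : Equiv.Perm _) x = k} =
      2 * k * (cosetTypeCT n ω).count k := by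
  rw [card_mpd_eq _ _ (eps_fpI n) (conj_fpI _ ω (eps_fpI n))]
  congr 1
  unfold cosetTypeCT
  rw [Multiset.count_map, Nat.card_eq_fintype_card, Fintype.card_subtype]
  simp only [Finset.card, Finset.filter, eq_comm]
  congr!

theorem ct_iff (n : ℕ) (ω : Equiv.Perm (Fin (2 * n))) (l : Multiset ℕ) (hl : ∀ p ∈ l, 2 ≤ p)
    (hn : l.sum ≤ n) :
    cosetTypeCT n ω = l + Multiset.replicate (n - l.sum) 1 ↔
      HTy (epsilonPerm n) (ω⁻¹ * epsilonPerm n * ω : Equiv.Perm _) l := by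
  have h0 : l.count 0 = 0 := Multiset.count_eq_zero.2 fun h => by have := hl _ h; omega
  have h1 : l.count 1 = 0 := Multiset.count_eq_zero.2 fun h => by have := hl _ h; omega
  constructor
  · intro h k hk
    rw [count_ct, h, Multiset.count_add, Multiset.count_replicate, if_neg (by omega), add_zero]
  · intro h
    have hc := card_eq_add_ne (eps_fpI n) (conj_fpI _ ω (eps_fpI n)) hl h
    rw [count_ct, Nat.card_eq_fintype_card, Fintype.card_fin] at hc
    ext k
    rw [Multiset.count_add, Multiset.count_replicate]
    rcases Nat.lt_or_ge k 2 with hk | hk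
    · interval_cases k
      · rw [h0]
        simp only [one_ne_zero, if_false, add_zero]
        rw [Multiset.count_eq_zero]
        intro hm
        unfold cosetTypeCT at hm
        rw [Multiset.mem_map] at hm
        obtain ⟨q, -, hq⟩ := hm
        exact (orb_zero_quot _ _ (eps_fpI n) (conj_fpI _ ω (eps_fpI n)) q).ne' hq
      · rw [h1, if_pos rfl]
        omega
    · have := h k hk
      rw [count_ct] at this
      rw [if_neg (by omega), add_zero]
      exact Nat.eq_of_mul_eq_mul_left (by omega) this

end bridge

section transport

theorem mpd_map {X Y : Type} {e m : X → X} {f h : Y → Y} (H : X → Y) (hi : Function.Injective H)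
    (h1 : ∀ x, H (e x) = f (H x)) (h2 : ∀ x, H (m x) = h (H x)) (x : X) :
    mpd f h (H x) = mpd e m x := by
  unfold mpd
  rw [Function.minimalPeriod_eq_minimalPeriod_iff]
  intro n
  have hs : Function.Semiconj H (fun x => e (m x)) (fun y => f (h y)) := by
    intro x
    show H (e (m x)) = f (h (H x))
    rw [h1, h2]
  unfold Function.IsPeriodicPt Function.IsFixedPt
  rw [← (hs.iterate_right n).eq, hi.eq_iff]

theorem HTy_map {X Y : Type} {e m : X → X} {f h : Y → Y} (H : X ≃ Y)
    (h1 : ∀ x, H (e x) = f (H x)) (h2 : ∀ x, H (m x) = h (H x)) (l : Multiset ℕ) :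
    HTy f h l ↔ HTy e m l := by
  unfold HTy
  have : ∀ k, Nat.card {x // mpd e m x = k} = Nat.card {y // mpd f h y = k} := fun k =>
    Nat.card_congr (H.subtypeEquiv fun x => by rw [mpd_map H H.injective h1 h2])
  simp only [this]

/-- Restriction to a subset outside which the two involutions agree. -/
theorem HTy_restrict {X : Type} (U : X → Prop) {e m : X → X} {f h : Subtype U → Subtype U}
    (he : FpI e)
    (h1 : ∀ x, (f x).1 = e x.1) (h2 : ∀ x, (h x).1 = m x.1)
    (hU : ∀ x, ¬ U x → e x = m x) (l : Multiset ℕ) :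
    HTy f h l ↔ HTy e m l := by
  have key : ∀ k, 2 ≤ k → Nat.card {x // mpd f h x = k} = Nat.card {y // mpd e m y = k} := by
    intro k hk
    have hx : ∀ x : Subtype U, mpd e m x.1 = mpd f h x :=
      mpd_map Subtype.val Subtype.val_injective h1 h2
    refine Nat.card_congr
      { toFun := fun x => ⟨x.1.1, by rw [hx, x.2]⟩
        invFun := fun y => ⟨⟨y.1, ?_⟩, ?_⟩
        left_inv := fun x => rfl
        right_inv := fun x => rfl }
    · by_contra hy
      have := (mpd_eq_one he _).2 (hU _ hy)
      rw [y.2] at this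
      omega
    · rw [← hx]; exact y.2
  unfold HTy
  exact forall₂_congr fun k hk => by rw [key k hk]

theorem FpI_map {X Y : Type} {e : X → X} {f : Y → Y} (H : X ≃ Y)
    (h1 : ∀ x, H (e x) = f (H x)) : FpI f ↔ FpI e := by
  unfold FpI
  rw [← H.forall_congr_right, ← H.forall_congr_right (q := fun y => f y ≠ y)]
  simp only [← h1, ne_eq, H.injective.eq_iff]

end transport

/-- Number of intermediate matchings moving every common edge. -/
noncomputable def gct (del lam : Multiset ℕ) {X : Type} (e e' : X → X) : ℕ :=
  Nat.card {m : X → X // FpI m ∧ HTy e m del ∧ HTy m e' lam ∧ ∀ x, e x = e' x → m x ≠ e x}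

theorem gct_map (del lam : Multiset ℕ) {X Y : Type} {e e' : X → X} {f f' : Y → Y} (H : X ≃ Y)
    (h1 : ∀ x, H (e x) = f (H x)) (h2 : ∀ x, H (e' x) = f' (H x)) :
    gct del lam e e' = gct del lam f f' := by
  unfold gct
  refine Nat.card_congr ((Equiv.arrowCongr H H).subtypeEquiv fun m => ?_)
  have h3 : ∀ x, H (m x) = (Equiv.arrowCongr H H m) (H x) := fun x => by simp
  rw [FpI_map H h3, HTy_map H h1 h3, HTy_map H h3 h2]
  rw [← H.forall_congr_right (q := fun y => f y = f' y → (Equiv.arrowCongr H H m) y ≠ f y)]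
  simp only [← h1, ← h2, ← h3, ne_eq, H.injective.eq_iff]

theorem gct_bound (del lam : Multiset ℕ) (hdel : ∀ p ∈ del, 2 ≤ p) (hlam : ∀ p ∈ lam, 2 ≤ p)
    {X : Type} [Finite X] {e e' : X → X} (he : FpI e) (he' : FpI e')
    (hc : 2 * (lam.sum + del.sum) < Nat.card X) : gct del lam e e' = 0 := by
  unfold gct
  rw [Nat.card_eq_zero]
  left
  constructor
  rintro ⟨m, hm, h1, h2, h3⟩
  have a := card_ne_eq he hm hdel h1
  have b := card_ne_eq hm he' hlam h2
  cases nonempty_fintype X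
  rw [Nat.card_eq_fintype_card, Fintype.card_subtype] at a b
  rw [Nat.card_eq_fintype_card] at hc
  have : (Finset.univ : Finset X) ⊆ Finset.univ.filter (fun x => e x ≠ m x) ∪
      Finset.univ.filter (fun x => m x ≠ e' x) := by
    intro x _
    simp only [Finset.mem_union, Finset.mem_filter, Finset.mem_univ, true_and]
    by_contra hx
    push Not at hx
    exact h3 x (hx.1.trans hx.2) hx.1.symm
  have h4 := Finset.card_le_card this
  have h5 := Finset.card_union_le (Finset.univ.filter (fun x => e x ≠ m x))
      (Finset.univ.filter (fun x => m x ≠ e' x))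
  rw [Finset.card_univ] at h4
  omega

theorem exists_v (del lam rho : Multiset ℕ) (hdel : ∀ p ∈ del, 2 ≤ p) (hlam : ∀ p ∈ lam, 2 ≤ p)
    (hrho : ∀ p ∈ rho, 2 ≤ p) (J : ℕ) :
    ∃ v : ℕ, (∀ (X : Type) [Finite X] (e e' : X → X), FpI e → FpI e' → HTy e e' rho →
      Nat.card X = 2 * (rho.sum + J) → gct del lam e e' = v) ∧
      (lam.sum + del.sum + 1 - rho.sum ≤ J → v = 0) := by
  by_cases hX : ∃ (X : Type) (_ : Finite X) (e e' : X → X), FpI e ∧ FpI e' ∧ HTy e e' rho ∧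
      Nat.card X = 2 * (rho.sum + J)
  · obtain ⟨X, _, e, e', he, he', ht, hc⟩ := hX
    refine ⟨gct del lam e e', ?_, ?_⟩
    · intro Y _ f f' hf hf' ht2 hc2
      obtain ⟨H, h1, h2⟩ := classify hf hf' he he' hrho ht2 ht (hc2.trans hc.symm)
      exact gct_map del lam H h1 h2
    · intro hJ
      exact gct_bound del lam hdel hlam he he' (by omega)
  · refine ⟨0, ?_, fun _ => rfl⟩
    intro X hf e e' he he' ht hc
    exact absurd ⟨X, hf, e, e', he, he', ht, hc⟩ hX

section slices
set_option linter.unusedSectionVars false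
set_option linter.unusedVariables false
variable {X : Type} [Fintype X] [LinearOrder X]

/-- Transversal of the common edges. -/
noncomputable def trv (e e' : X → X) : Finset X :=
  Finset.univ.filter (fun x => x < e x ∧ e x = e' x)

/-- Complement of the common edges not indexed by `T`. -/
def USet (e e' : X → X) (T : Finset X) (x : X) : Prop := e x ≠ e' x ∨ x ∈ T ∨ e x ∈ T

variable {e e' : X → X} {T : Finset X}

theorem USet_e (he : FpI e) (he' : FpI e') (x : X) (h : USet e e' T x) : USet e e' T (e x) := by
  rcases h with h | h | h
  · left
    intro h2
    rw [he.1] at h2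
    apply h
    rw [← he'.1 (e x), ← h2]
  · right; right; rwa [he.1]
  · right; left; exact h

theorem USet_e' (he : FpI e) (he' : FpI e') (x : X) (h : USet e e' T x) :
    USet e e' T (e' x) := by
  by_cases hx : e x = e' x
  · rw [← hx]; exact USet_e he he' x h
  · left
    intro h2
    rw [he'.1] at h2
    apply hx
    rw [← he.1 (e' x), h2]

theorem mem_trv {x : X} : x ∈ trv e e' ↔ x < e x ∧ e x = e' x := by simp [trv]

theorem trv_or (he : FpI e) (he' : FpI e') (x : X) (h : e x = e' x) :
    x ∈ trv e e' ∨ e x ∈ trv e e' := by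
  rcases lt_or_gt_of_ne (he.2 x) with h1 | h1
  · right
    rw [mem_trv, he.1]
    refine ⟨h1, ?_⟩
    rw [h, he'.1]
  · left
    exact mem_trv.2 ⟨h1, h⟩

theorem not_both (he : FpI e) {x : X} (h : x ∈ trv e e') (h2 : e x ∈ trv e e') : False := by
  rw [mem_trv] at h h2
  rw [he.1] at h2
  exact lt_asymm h.1 h2.1

theorem card_USet (he : FpI e) (he' : FpI e') {rho : Multiset ℕ} (hrho : ∀ p ∈ rho, 2 ≤ p)
    (ht : HTy e e' rho) (hT : T ⊆ trv e e') :
    Nat.card (Subtype (USet e e' T)) = 2 * (rho.sum + T.card) := by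
  have h0 := card_ne_eq he he' hrho ht
  rw [Nat.card_eq_fintype_card, Fintype.card_subtype] at h0 ⊢
  have : Finset.univ.filter (USet e e' T) =
      Finset.univ.filter (fun x => e x ≠ e' x) ∪ (T ∪ T.image e) := by
    ext x
    simp only [Finset.mem_filter, Finset.mem_univ, true_and, Finset.mem_union, Finset.mem_image,
      USet]
    have : e x ∈ T ↔ ∃ a ∈ T, e a = x :=
      ⟨fun h => ⟨_, h, he.1 x⟩, by rintro ⟨a, ha, rfl⟩; rwa [he.1]⟩
    rw [this]
  rw [this, Finset.card_union_of_disjoint, Finset.card_union_of_disjoint, h0,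
    Finset.card_image_of_injective _ he.inj]
  · ring
  · rw [Finset.disjoint_left]
    intro x hx hx2
    obtain ⟨a, ha, rfl⟩ := Finset.mem_image.1 hx2
    exact not_both he (hT ha) (hT hx)
  · rw [Finset.disjoint_left]
    intro x hx hx2
    have hx' : e x ≠ e' x := by simpa using hx
    rcases Finset.mem_union.1 hx2 with h | h
    · exact hx' (mem_trv.1 (hT h)).2
    · obtain ⟨a, ha, rfl⟩ := Finset.mem_image.1 h
      have := (mem_trv.1 (hT ha)).2
      apply hx'
      rw [he.1, this, he'.1]

theorem card_trv (he : FpI e) (he' : FpI e') {rho : Multiset ℕ} (hrho : ∀ p ∈ rho, 2 ≤ p)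
    (ht : HTy e e' rho) : Nat.card X = 2 * (rho.sum + (trv e e').card) := by
  rw [← card_USet he he' hrho ht subset_rfl]
  refine (Nat.card_congr (Equiv.subtypeUnivEquiv fun x => ?_)).symm
  by_cases h : e x = e' x
  · exact Or.inr (trv_or he he' x h)
  · exact Or.inl h

theorem USet_of (he : FpI e) (he' : FpI e') {x : X} (hT : T ⊆ trv e e') (hx : x ∈ trv e e')
    (h : USet e e' T x) : x ∈ T := by
  rcases h with h | h | h
  · exact absurd (mem_trv.1 hx).2 h
  · exact h
  · exact (not_both he hx (hT h)).elim

theorem slice_out (he : FpI e) (he' : FpI e') {m : X → X} (hm : FpI m)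
    (hs : (trv e e').filter (fun x => m x ≠ e x) = T) (x : X) (hx : ¬ USet e e' T x) :
    m x = e x := by
  unfold USet at hx
  push Not at hx
  obtain ⟨h1, h2, h3⟩ := hx
  rw [← hs] at h2 h3
  simp only [Finset.mem_filter, not_and, not_not] at h2 h3
  rcases trv_or he he' x h1 with h | h
  · exact h2 h
  · have := h3 h
    rw [he.1] at this
    rw [← this, hm.1, this]

theorem slice_in (he : FpI e) (he' : FpI e') {m : X → X} (hm : FpI m)
    (hs : (trv e e').filter (fun x => m x ≠ e x) = T) (x : X) (hx : USet e e' T x) :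
    USet e e' T (m x) := by
  by_contra h
  have h1 := slice_out he he' hm hs _ h
  rw [hm.1] at h1
  apply h
  have := USet_e he he' _ hx
  rwa [h1, he.1] at this

theorem slice_card (del lam : Multiset ℕ) (he : FpI e) (he' : FpI e') (hT : T ⊆ trv e e') :
    Nat.card {m : X → X // (FpI m ∧ HTy e m del ∧ HTy m e' lam) ∧
      (trv e e').filter (fun x => m x ≠ e x) = T} =
    gct del lam (Subtype.map e (USet_e he he') : Subtype (USet e e' T) → _)
      (Subtype.map e' (USet_e' he he')) := by
  have hout : ∀ x, ¬ USet e e' T x → e x = e' x := fun x hx => by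
    by_contra h
    exact hx (Or.inl h)
  unfold gct
  refine Nat.card_congr
    { toFun := fun m => ⟨Subtype.map m.1 (slice_in he he' m.2.1.1 m.2.2), ?_⟩
      invFun := fun k => ⟨fun x => if h : USet e e' T x then (k.1 ⟨x, h⟩).1 else e x, ?_⟩
      left_inv := ?_
      right_inv := ?_ }
  · obtain ⟨m, ⟨hm, h1, h2⟩, hs⟩ := m
    have ho := slice_out he he' hm hs
    refine ⟨⟨fun x => Subtype.ext (hm.1 x.1), fun x h => hm.2 x.1 (congrArg Subtype.val h)⟩,
      ?_, ?_, ?_⟩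
    · exact (HTy_restrict _ he (fun _ => rfl) (fun _ => rfl) (fun x hx => (ho x hx).symm) _).2 h1
    · exact (HTy_restrict _ hm (fun _ => rfl) (fun _ => rfl)
        (fun x hx => (ho x hx).trans (hout x hx)) _).2 h2
    · rintro ⟨x, hx⟩ hee hme
      have hee' : e x = e' x := congrArg Subtype.val hee
      have hme' : m x = e x := congrArg Subtype.val hme
      rcases hx with h | h | h
      · exact h hee'
      · rw [← hs, Finset.mem_filter] at h
        exact h.2 hme'
      · rw [← hs, Finset.mem_filter] at h
        apply h.2
        rw [he.1, ← hme', hm.1]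
  · obtain ⟨k, hk, h1, h2, h3⟩ := k
    have hin : ∀ x (h : USet e e' T x),
        (if h : USet e e' T x then (k ⟨x, h⟩).1 else e x) = (k ⟨x, h⟩).1 := fun x h => dif_pos h
    have ho : ∀ x, ¬ USet e e' T x →
        (if h : USet e e' T x then (k ⟨x, h⟩).1 else e x) = e x := fun x h => dif_neg h
    have hm : FpI (fun x => if h : USet e e' T x then (k ⟨x, h⟩).1 else e x) := by
      constructor
      · intro x
        by_cases h : USet e e' T x
        · simp only [hin x h]
          rw [hin _ (k ⟨x, h⟩).2, hk.1]
        · simp only [ho x h]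
          rw [ho, he.1]
          intro h2
          have := USet_e he he' _ h2
          rw [he.1] at this
          exact h this
      · intro x
        by_cases h : USet e e' T x
        · simp only [hin x h]
          intro h2
          exact hk.2 ⟨x, h⟩ (Subtype.ext h2)
        · simp only [ho x h]
          exact he.2 x
    refine ⟨⟨hm, ?_, ?_⟩, ?_⟩
    · exact (HTy_restrict _ he (fun _ => rfl) (fun x => (hin x.1 x.2).symm)
        (fun x hx => (ho x hx).symm) _).1 h1
    · exact (HTy_restrict _ hm (fun x => (hin x.1 x.2).symm) (fun _ => rfl)
        (fun x hx => (ho x hx).trans (hout x hx)) _).1 h2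
    · ext x
      rw [Finset.mem_filter]
      constructor
      · rintro ⟨hx, hne⟩
        apply USet_of he he' hT hx
        by_contra h
        exact hne (ho x h)
      · intro hx
        refine ⟨hT hx, ?_⟩
        have hU : USet e e' T x := Or.inr (Or.inl hx)
        simp only [hin x hU]
        intro h
        exact h3 ⟨x, hU⟩ (Subtype.ext (mem_trv.1 (hT hx)).2) (Subtype.ext h)
  · rintro ⟨m, ⟨hm, h1, h2⟩, hs⟩
    apply Subtype.ext
    funext x
    by_cases h : USet e e' T x
    · simp only [dif_pos h]; rfl
    · simp only [dif_neg h]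
      exact (slice_out he he' hm hs x h).symm
  · rintro ⟨k, hk⟩
    apply Subtype.ext
    funext x
    apply Subtype.ext
    exact dif_pos x.2

theorem total_card (del lam rho : Multiset ℕ) (hrho : ∀ p ∈ rho, 2 ≤ p)
    (he : FpI e) (he' : FpI e') (ht : HTy e e' rho) (v : ℕ → ℕ)
    (hv : ∀ (J : ℕ) (X : Type) [Finite X] (e e' : X → X), FpI e → FpI e' → HTy e e' rho →
      Nat.card X = 2 * (rho.sum + J) → gct del lam e e' = v J) :
    Nat.card {m : X → X // FpI m ∧ HTy e m del ∧ HTy m e' lam} =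
      ∑ J ∈ Finset.range ((trv e e').card + 1), (trv e e').card.choose J * v J := by
  have h1 : ∀ T ∈ (trv e e').powerset, Nat.card {m : X → X // (FpI m ∧ HTy e m del ∧
      HTy m e' lam) ∧ (trv e e').filter (fun x => m x ≠ e x) = T} = v T.card := by
    intro T hT
    rw [Finset.mem_powerset] at hT
    rw [slice_card del lam he he' hT]
    apply hv
    · exact ⟨fun x => Subtype.ext (he.1 x.1), fun x h => he.2 x.1 (congrArg Subtype.val h)⟩
    · exact ⟨fun x => Subtype.ext (he'.1 x.1), fun x h => he'.2 x.1 (congrArg Subtype.val h)⟩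
    · refine (HTy_restrict _ he (fun _ => rfl) (fun _ => rfl) (fun x hx => ?_) _).2 ht
      by_contra h
      exact hx (Or.inl h)
    · exact card_USet he he' hrho ht hT
  have h2 := Finset.sum_powerset_apply_card v (x := trv e e')
  simp only [smul_eq_mul] at h2
  rw [← h2, ← Finset.sum_congr rfl h1, Nat.card_eq_fintype_card, Fintype.card_subtype,
    Finset.card_eq_sum_card_fiberwise (f := fun m : X → X => (trv e e').filter (fun x => m x ≠ e x))
      (t := (trv e e').powerset)]
  · refine Finset.sum_congr rfl fun T _ => ?_
    rw [Nat.card_eq_fintype_card, Fintype.card_subtype, Finset.filter_filter]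
  · intro m _
    simp only [Finset.mem_coe, Finset.mem_powerset]
    exact Finset.filter_subset _ _

end slices

section step1

theorem cycleType_fpI (n : ℕ) (g : Equiv.Perm (Fin (2 * n))) (hg : FpI g) :
    g.cycleType = Multiset.replicate n 2 := by
  have hsq : g ^ 2 = 1 := by
    ext x
    rw [pow_two]
    simp [hg.1]
  have h2 : ∀ p ∈ g.cycleType, p = 2 := by
    intro p hp
    have a := Equiv.Perm.two_le_of_mem_cycleType hp
    have b := (Equiv.Perm.dvd_of_mem_cycleType hp).trans (orderOf_dvd_of_pow_eq_one hsq)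
    have := Nat.le_of_dvd (by norm_num) b
    omega
  have hr := Multiset.eq_replicate_card.2 h2
  have hs := Equiv.Perm.sum_cycleType g
  have hsupp : g.support = Finset.univ := by
    ext x
    simpa using hg.2 x
  rw [hsupp, Finset.card_univ, Fintype.card_fin, hr, Multiset.sum_replicate, smul_eq_mul] at hs
  rw [hr, show Multiset.card g.cycleType = n by omega]

theorem card_cent (n : ℕ) : Nat.card (Subgroup.centralizer {epsilonPerm n}) =
    2 ^ n * n.factorial := by
  rw [Equiv.Perm.nat_card_centralizer, cycleType_fpI n _ (eps_fpI n)]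
  rcases Nat.eq_zero_or_pos n with rfl | hn
  · simp
  · rw [Multiset.toFinset_replicate, if_neg (by omega)]
    simp [Multiset.sum_replicate, mul_comm]

theorem card_fiber (n : ℕ) (m : Fin (2 * n) → Fin (2 * n)) (hm : FpI m) :
    Nat.card {t : Equiv.Perm (Fin (2 * n)) // ⇑(t⁻¹ * epsilonPerm n * t) = m} =
      2 ^ n * n.factorial := by
  rw [← card_cent]
  have hconj : IsConj (Function.Involutive.toPerm m hm.1) (epsilonPerm n) := by
    rw [Equiv.Perm.isConj_iff_cycleType_eq, cycleType_fpI n _ (eps_fpI n), cycleType_fpI n]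
    exact hm
  obtain ⟨c, hc⟩ := isConj_iff.1 hconj
  have hmc : Function.Involutive.toPerm m hm.1 = c⁻¹ * epsilonPerm n * c := by
    rw [← hc]; group
  have hiff : ∀ t : Equiv.Perm (Fin (2 * n)), ⇑(t⁻¹ * epsilonPerm n * t) = m ↔
      t * c⁻¹ ∈ Subgroup.centralizer {epsilonPerm n} := by
    intro t
    have : ⇑(t⁻¹ * epsilonPerm n * t) = m ↔
        t⁻¹ * epsilonPerm n * t = c⁻¹ * epsilonPerm n * c := by
      rw [← hmc]
      exact ⟨fun h => Equiv.ext fun x => congrFun h x, fun h => by rw [h]; rfl⟩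
    rw [this, Subgroup.mem_centralizer_singleton_iff]
    constructor
    · intro h
      calc t * c⁻¹ * epsilonPerm n = t * (c⁻¹ * epsilonPerm n * c) * c⁻¹ := by group
        _ = _ := by rw [← h]; group
    · intro h
      calc t⁻¹ * epsilonPerm n * t = t⁻¹ * (epsilonPerm n * (t * c⁻¹)) * c := by group
        _ = _ := by rw [← h]; group
  exact Nat.card_congr ((Equiv.mulRight c⁻¹).subtypeEquiv hiff)

theorem card_pairs (lam del : Multiset ℕ) (hlam : ∀ p ∈ lam, 2 ≤ p) (hdel : ∀ p ∈ del, 2 ≤ p)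
    (n : ℕ) (h1 : lam.sum ≤ n) (h2 : del.sum ≤ n) (π : Equiv.Perm (Fin (2 * n))) :
    Nat.card {p : Equiv.Perm (Fin (2 * n)) × Equiv.Perm (Fin (2 * n)) //
              cosetTypeCT n p.1 = lam + Multiset.replicate (n - lam.sum) 1 ∧
              cosetTypeCT n p.2 = del + Multiset.replicate (n - del.sum) 1 ∧
              p.1 * p.2 = π} =
    2 ^ n * n.factorial * Nat.card {m : Fin (2 * n) → Fin (2 * n) // FpI m ∧
      HTy (epsilonPerm n) m del ∧ HTy m (π⁻¹ * epsilonPerm n * π : Equiv.Perm _) lam} := by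
  have hs : ∀ s t : Equiv.Perm (Fin (2 * n)), s * t = π →
      (HTy (epsilonPerm n) (s⁻¹ * epsilonPerm n * s : Equiv.Perm _) lam ↔
       HTy (t⁻¹ * epsilonPerm n * t : Equiv.Perm _) (π⁻¹ * epsilonPerm n * π : Equiv.Perm _)
         lam) := by
    rintro s t rfl
    refine HTy_map t ?_ ?_ lam
    · intro x; simp
    · intro x; simp
  have E : {p : Equiv.Perm (Fin (2 * n)) × Equiv.Perm (Fin (2 * n)) //
              cosetTypeCT n p.1 = lam + Multiset.replicate (n - lam.sum) 1 ∧
              cosetTypeCT n p.2 = del + Multiset.replicate (n - del.sum) 1 ∧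
              p.1 * p.2 = π} ≃ {t : Equiv.Perm (Fin (2 * n)) //
        FpI (t⁻¹ * epsilonPerm n * t : Equiv.Perm _) ∧
        HTy (epsilonPerm n) (t⁻¹ * epsilonPerm n * t : Equiv.Perm _) del ∧
        HTy (t⁻¹ * epsilonPerm n * t : Equiv.Perm _) (π⁻¹ * epsilonPerm n * π : Equiv.Perm _)
         lam} :=
    { toFun := fun p => ⟨p.1.2, conj_fpI _ _ (eps_fpI n), (ct_iff n _ del hdel h2).1 p.2.2.1,
        (hs _ _ p.2.2.2).1 ((ct_iff n _ lam hlam h1).1 p.2.1)⟩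
      invFun := fun t => ⟨(π * t.1⁻¹, t.1), (ct_iff n _ lam hlam h1).2
        ((hs (π * t.1⁻¹) t.1 (by group)).2 t.2.2.2), (ct_iff n _ del hdel h2).2 t.2.2.1, by group⟩
      left_inv := by
        rintro ⟨⟨s, t⟩, ha, hb, rfl⟩
        apply Subtype.ext
        simp
      right_inv := fun t => rfl }
  rw [Nat.card_congr E, Nat.card_eq_fintype_card, Nat.card_eq_fintype_card, Fintype.card_subtype,
    Fintype.card_subtype]
  rw [Finset.card_eq_sum_card_fiberwise
    (f := fun t : Equiv.Perm (Fin (2 * n)) => ⇑(t⁻¹ * epsilonPerm n * t))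
    (t := Finset.univ.filter (fun m : Fin (2 * n) → Fin (2 * n) => FpI m ∧
      HTy (epsilonPerm n) m del ∧ HTy m (π⁻¹ * epsilonPerm n * π : Equiv.Perm _) lam))]
  · rw [Finset.sum_congr rfl (g := fun _ => 2 ^ n * n.factorial), Finset.sum_const, smul_eq_mul]
    · exact Nat.mul_comm _ _
    · intro m hm
      simp only [Finset.mem_filter, Finset.mem_univ, true_and] at hm
      rw [← card_fiber n m hm.1, Nat.card_eq_fintype_card, Fintype.card_subtype,
        Finset.filter_filter]
      congr 1
      ext t
      simp only [Finset.mem_filter, Finset.mem_univ, true_and, and_iff_right_iff_imp]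
      intro ht
      rw [ht]
      exact hm
  · intro t ht
    exact Finset.mem_coe.2 (Finset.mem_filter.2 ⟨Finset.mem_univ _,
      (Finset.mem_filter.1 (Finset.mem_coe.1 ht)).2⟩)

end step1

/-- Polynomiality of the structure coefficients of the Hecke algebra
`ℂ[B_n\S_{2n}/B_n]`: for proper partitions `λ`, `δ`, `ρ` (multisets of parts, all `≥ 2`),
the structure coefficient `α_{λδ}^{ρ}(n)` equals `2^n n!` times a polynomial in `n` with
nonnegative rational coefficients in the falling-factorial basis `(n-|ρ|)⋯(n-|ρ|-j+1)`. -/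
theorem stmt13 (lam del rho : Multiset ℕ)
    (hlam : ∀ p ∈ lam, 2 ≤ p) (hdel : ∀ p ∈ del, 2 ≤ p) (hrho : ∀ p ∈ rho, 2 ≤ p) :
    ∃ a : ℕ → ℚ, (∀ j, 0 ≤ a j) ∧
      ∀ n : ℕ, lam.sum ≤ n → del.sum ≤ n → rho.sum ≤ n →
        ∀ π : Equiv.Perm (Fin (2 * n)),
          cosetTypeCT n π = rho + Multiset.replicate (n - rho.sum) 1 →
          (Nat.card {p : Equiv.Perm (Fin (2 * n)) × Equiv.Perm (Fin (2 * n)) //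
              cosetTypeCT n p.1 = lam + Multiset.replicate (n - lam.sum) 1 ∧
              cosetTypeCT n p.2 = del + Multiset.replicate (n - del.sum) 1 ∧
              p.1 * p.2 = π} : ℚ) =
            2 ^ n * (n.factorial : ℚ) *
              ∑ j ∈ Finset.range (lam.sum + del.sum + 1 - rho.sum),
                a j * ∏ t ∈ Finset.range j, ((n : ℚ) - (rho.sum : ℚ) - (t : ℚ)) := by
  choose v hv hv0 using exists_v del lam rho hdel hlam hrho
  refine ⟨fun j => (v j : ℚ) / (j.factorial : ℚ), fun j => by positivity, ?_⟩
  intro n h1 h2 h3 π hπ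
  have ht := (ct_iff n π rho hrho h3).1 hπ
  have he := eps_fpI n
  have he' := conj_fpI _ π (eps_fpI n)
  rw [card_pairs lam del hlam hdel n h1 h2 π, total_card del lam rho hrho he he' ht v hv]
  have hN := card_trv he he' hrho ht
  rw [Nat.card_eq_fintype_card, Fintype.card_fin] at hN
  generalize (trv (epsilonPerm n) (π⁻¹ * epsilonPerm n * π : Equiv.Perm _)).card = N at hN ⊢
  simp only [Nat.cast_mul, Nat.cast_pow, Nat.cast_ofNat, Nat.cast_sum]
  congr 1
  have hterm : ∀ j, (v j : ℚ) / (j.factorial : ℚ) *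
      ∏ t ∈ Finset.range j, ((n : ℚ) - (rho.sum : ℚ) - (t : ℚ)) = (N.choose j : ℚ) * v j := by
    intro j
    have hp : ∏ t ∈ Finset.range j, ((n : ℚ) - (rho.sum : ℚ) - (t : ℚ)) =
        (j.factorial : ℚ) * (N.choose j : ℚ) := by
      have hn : (n : ℚ) = rho.sum + N := by
        have : n = rho.sum + N := by omega
        rw [this]; push_cast; ring
      rw [← Nat.cast_mul, ← Nat.descFactorial_eq_factorial_mul_choose]
      rw [hn]
      clear hN hn hv hv0
      induction j with
      | zero => simp
      | succ j ih =>
        rw [Finset.prod_range_succ, ih, Nat.descFactorial_succ]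
        rcases le_or_gt j N with hj | hj
        · rw [Nat.cast_mul, Nat.cast_sub hj]; ring
        · rw [Nat.descFactorial_of_lt hj]; simp
    have hf : (j.factorial : ℚ) ≠ 0 := by positivity
    rw [hp]
    field_simp
  rw [Finset.sum_congr rfl fun j _ => hterm j]
  have hz1 : ∀ j, j ∉ Finset.range (N + 1) → (N.choose j : ℚ) * v j = 0 := by
    intro j hj
    rw [Finset.mem_range] at hj
    rw [Nat.choose_eq_zero_of_lt (by omega)]
    simp
  have hz2 : ∀ j, j ∉ Finset.range (lam.sum + del.sum + 1 - rho.sum) →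
      (N.choose j : ℚ) * v j = 0 := by
    intro j hj
    rw [Finset.mem_range] at hj
    rw [hv0 j (by omega)]
    simp
  rw [← finsum_eq_sum_of_support_subset, ← finsum_eq_sum_of_support_subset]
  · intro j hj
    by_contra h
    exact hj (hz2 j h)
  · intro j hj
    by_contra h
    exact hj (hz1 j h)
end

section
/- Let n ≥ 1, let 0 ≤ k₁, k₂ ≤ n, and let z ∈ S_n. Then {a∘z∘b : a ∈ S_{n+1}^{k₁}, b ∈ S_{n+1}^{k₂}} ∩ S_n = {a∘z∘b : a ∈ S_n^{k₁}, b ∈ S_n^{k₂}}. -/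
/-- `SFix m` is the subgroup `S_m` of the permutations of the positive integers:
those fixing every `x > m`. -/
def SFix (m : ℕ) : Set (Equiv.Perm ℕ+) :=
  {σ : Equiv.Perm ℕ+ | ∀ x : ℕ+, m < (x : ℕ) → σ x = x}

/-- `SFixK m k` is the subgroup `S_m^k`: permutations fixing every `x > m`
and every `x ≤ k`. -/
def SFixK (m k : ℕ) : Set (Equiv.Perm ℕ+) :=
  {σ : Equiv.Perm ℕ+ | (∀ x : ℕ+, m < (x : ℕ) → σ x = x) ∧ ∀ x : ℕ+, (x : ℕ) ≤ k → σ x = x}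

/-- Hypothesis H.4 for symmetric groups:
`S_{n+1}^{k₁} z S_{n+1}^{k₂} ∩ S_n = S_n^{k₁} z S_n^{k₂}`. -/
theorem stmt14 (n k₁ k₂ : ℕ) (hn : 1 ≤ n) (h₁ : k₁ ≤ n) (h₂ : k₂ ≤ n)
    (z : Equiv.Perm ℕ+) (hz : z ∈ SFix n) :
    {g : Equiv.Perm ℕ+ | ∃ a ∈ SFixK (n + 1) k₁, ∃ b ∈ SFixK (n + 1) k₂, g = a * z * b} ∩
        SFix n =
      {g : Equiv.Perm ℕ+ | ∃ a ∈ SFixK n k₁, ∃ b ∈ SFixK n k₂, g = a * z * b} := by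
  ext g
  constructor
  · rintro ⟨⟨a, ⟨ha1, ha2⟩, b, ⟨hb1, hb2⟩, rfl⟩, hg⟩
    obtain ⟨N, hN⟩ : ∃ N : ℕ+, (N : ℕ) = n + 1 := ⟨⟨n + 1, Nat.succ_pos n⟩, rfl⟩
    have hzN : z N = N := hz N (by omega)
    have hq : a (z (b N)) = N := hg N (by omega)
    have key : ∀ x : ℕ+, n < (x : ℕ) → x = N ∨ n + 1 < (x : ℕ) := by
      intro x hx
      by_cases h : (x : ℕ) = n + 1
      · left
        apply PNat.eq
        omega
      · right
        omega
    have hA : ∀ x : ℕ+, a x = x → x ≠ N → Equiv.swap (z (b N)) N x = x := by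
      intro x hx hne
      apply Equiv.swap_apply_of_ne_of_ne _ hne
      intro h
      rw [← h, hx] at hq
      exact hne hq
    have hB : ∀ x : ℕ+, b x = x → x ≠ N → Equiv.swap (b N) N x = x := by
      intro x hx hne
      apply Equiv.swap_apply_of_ne_of_ne _ hne
      intro h
      exact hne (b.injective (hx.trans h))
    have hne1 : ∀ x : ℕ+, n + 1 < (x : ℕ) → x ≠ N := by
      rintro x hx rfl
      omega
    have hne2 : ∀ x : ℕ+, (x : ℕ) ≤ n → x ≠ N := by
      rintro x hx rfl
      omega
    refine ⟨a * Equiv.swap (z (b N)) N, ⟨?_, ?_⟩, Equiv.swap (b N) N * b, ⟨?_, ?_⟩, ?_⟩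
    · intro x hx
      rcases key x hx with rfl | h
      · simp [hq]
      · rw [Equiv.Perm.mul_apply, hA x (ha1 x h) (hne1 x h), ha1 x h]
    · intro x hx
      rw [Equiv.Perm.mul_apply, hA x (ha2 x hx) (hne2 x (hx.trans h₁)), ha2 x hx]
    · intro x hx
      rcases key x hx with rfl | h
      · simp
      · rw [Equiv.Perm.mul_apply, hb1 x h, hB x (hb1 x h) (hne1 x h)]
    · intro x hx
      rw [Equiv.Perm.mul_apply, hb2 x hx, hB x (hb2 x hx) (hne2 x (hx.trans h₂))]
    · have h := Equiv.mul_swap_eq_swap_mul z (b N) N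
      rw [hzN] at h
      have h2 : Equiv.swap (z (b N)) N * z * Equiv.swap (b N) N = z := by
        rw [← h, mul_assoc, Equiv.swap_mul_self, mul_one]
      calc a * z * b = a * (Equiv.swap (z (b N)) N * z * Equiv.swap (b N) N) * b := by rw [h2]
        _ = _ := by simp only [mul_assoc]
  · rintro ⟨a, ⟨ha1, ha2⟩, b, ⟨hb1, hb2⟩, rfl⟩
    refine ⟨⟨a, ⟨fun x hx => ha1 x (by omega), ha2⟩, b,
      ⟨fun x hx => hb1 x (by omega), hb2⟩, rfl⟩, ?_⟩
    intro x hx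
    rw [Equiv.Perm.mul_apply, Equiv.Perm.mul_apply, hb1 x hx, hz x hx, ha1 x hx]
end

section
/- Let n ≥ 1, let 0 ≤ k₁, k₂ ≤ n, let z ∈ S_n, and set m := #({1,…,k₂} ∪ {z(1),…,z(k₁)}). Then there exist a ∈ S_n^{k₁} and b ∈ S_n^{k₂} such that (b∘z∘a)(x) = x for every x > m, i.e. b∘z∘a ∈ S_m; moreover m ≤ k₁ + k₂. (In the terminology of the paper: the least k such that the double coset S_n^{k₁} z S_n^{k₂} meets S_k is at most #({1,…,k₂} ∪ {z(1),…,z(k₁)}) ≤ k₁ + k₂.) -/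
lemma aux_ext (s A t : Finset ℕ+) (hc : A.card = t.card) (hs : s ⊆ A) (f : ℕ+ → ℕ+)
    (hf : ∀ x ∈ s, f x ∈ t) (hi : Set.InjOn f s) :
    ∃ e : A ≃ t, ∀ x : A, (x : ℕ+) ∈ s → (e x : ℕ+) = f x := by
  classical
  obtain ⟨g, hg⟩ := Finset.exists_equiv_extend_of_card_eq (α := A) (t := t)
    (by simpa using hc) (s := Finset.univ.filter (fun x : A => (x : ℕ+) ∈ s))
    (f := fun x => f x)
    (by
      intro y hy
      simp only [Finset.mem_image, Finset.mem_filter, Finset.mem_univ, true_and] at hy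
      obtain ⟨x, hx, rfl⟩ := hy
      exact hf _ hx)
    (by
      intro x hx y hy h
      simp only [Finset.coe_filter, Finset.mem_univ, true_and, Set.mem_setOf_eq] at hx hy
      exact Subtype.ext (hi hx hy h))
  exact ⟨g, fun x hx => hg x (by simpa using hx)⟩

lemma aux_perm (s T : Finset ℕ+) (hs : s ⊆ T) (f : ℕ+ → ℕ+)
    (hf : ∀ x ∈ s, f x ∈ T) (hi : Set.InjOn f s) :
    ∃ e : Equiv.Perm ℕ+, (∀ x ∈ s, e x = f x) ∧ ∀ x, x ∉ T → e x = x := by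
  classical
  obtain ⟨e, he⟩ := aux_ext s T T rfl hs f hf hi
  refine ⟨Equiv.Perm.ofSubtype (p := fun x => x ∈ T) e, ?_, ?_⟩
  · intro x hx
    rw [Equiv.Perm.ofSubtype_apply_of_mem (p := fun x => x ∈ T) e (hs hx)]
    exact he ⟨x, hs hx⟩ hx
  · intro x hx
    exact Equiv.Perm.ofSubtype_apply_of_not_mem (p := fun x => x ∈ T) e hx

lemma aux_P (k : ℕ) : ∃ P : Finset ℕ+, (∀ x : ℕ+, x ∈ P ↔ (x : ℕ) ≤ k) ∧ P.card = k := by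
  classical
  refine ⟨(Finset.range k).image Nat.succPNat, ?_, ?_⟩
  · intro x
    simp only [Finset.mem_image, Finset.mem_range]
    constructor
    · rintro ⟨y, hy, rfl⟩
      simpa using hy
    · intro h
      have := x.pos
      exact ⟨x.natPred, by have := x.natPred_add_one; omega, PNat.succPNat_natPred x⟩
  · rw [Finset.card_image_of_injective _ Nat.succPNat_injective, Finset.card_range]

/-- Hypothesis H.5 for symmetric groups: the double coset `S_n^{k₁} z S_n^{k₂}` meets `S_m`
where `m = #({1,…,k₂} ∪ {z(1),…,z(k₁)}) ≤ k₁ + k₂`. -/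
theorem stmt15 (n k₁ k₂ : ℕ) (hn : 1 ≤ n) (h₁ : k₁ ≤ n) (h₂ : k₂ ≤ n)
    (z : Equiv.Perm ℕ+) (hz : z ∈ SFix n)
    (m : ℕ)
    (hm : m = Nat.card ↥({x : ℕ+ | (x : ℕ) ≤ k₂} ∪ ⇑z '' {x : ℕ+ | (x : ℕ) ≤ k₁})) :
    (∃ a ∈ SFixK n k₁, ∃ b ∈ SFixK n k₂,
        ∀ x : ℕ+, m < (x : ℕ) → (b * z * a) x = x) ∧
      m ≤ k₁ + k₂ := by
  classical
  obtain ⟨P1, hP1, c1⟩ := aux_P k₁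
  obtain ⟨P2, hP2, c2⟩ := aux_P k₂
  obtain ⟨Pn, hPn, cn⟩ := aux_P n
  obtain ⟨Pm, hPm, cm⟩ := aux_P m
  have hzn : ∀ x, z x ∈ Pn ↔ x ∈ Pn := by
    intro x
    simp only [hPn]
    constructor
    · intro h
      by_contra h'
      rw [hz x (by omega)] at h
      exact h' h
    · intro h
      by_contra h'
      have := z.injective (hz (z x) (by omega))
      rw [this] at h'
      exact h' h
  set A : Finset ℕ+ := P2 ∪ P1.image z with hA
  have hAm : A.card = m := by
    have : ({x : ℕ+ | (x : ℕ) ≤ k₂} ∪ ⇑z '' {x : ℕ+ | (x : ℕ) ≤ k₁}) = (A : Set ℕ+) := by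
      ext x
      simp [hA, hP1, hP2]
    rw [hm, this]
    simp
  have hci : (P1.image z).card = k₁ := by
    rw [Finset.card_image_of_injective _ z.injective, c1]
  have hm12 : m ≤ k₁ + k₂ := by
    have := Finset.card_union_le P2 (P1.image z)
    rw [← hA] at this
    omega
  have hk1m : k₁ ≤ m := by
    have := Finset.card_le_card (Finset.subset_union_right : P1.image z ⊆ P2 ∪ P1.image z)
    rw [← hA] at this
    omega
  have hk2m : k₂ ≤ m := by
    have := Finset.card_le_card (Finset.subset_union_left : P2 ⊆ P2 ∪ P1.image z)
    rw [← hA] at this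
    omega
  have hAn : A ⊆ Pn := by
    intro x hx
    rw [hA, Finset.mem_union, Finset.mem_image] at hx
    rcases hx with hx | ⟨y, hy, rfl⟩
    · rw [hP2] at hx; rw [hPn]; omega
    · rw [hP1] at hy; rw [hzn, hPn]; omega
  have hmn : m ≤ n := by
    have := Finset.card_le_card hAn
    omega
  refine ⟨?_, hm12⟩
  obtain ⟨e, he⟩ := aux_ext P2 A Pm (by rw [hAm, cm]) Finset.subset_union_left id
    (by intro x hx; rw [hP2] at hx; simp only [id, hPm]; omega) Function.injective_id.injOn
  obtain ⟨b, hb1, hb2⟩ := aux_perm A Pn hAn (fun x => if h : x ∈ A then (e ⟨x, h⟩ : ℕ+) else x)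
    (by
      intro x hx
      have := (e ⟨x, hx⟩).2
      rw [hPm] at this
      simp only [hx, dif_pos, hPn]
      omega)
    (by
      intro x hx y hy h
      have hx' : x ∈ A := hx
      have hy' : y ∈ A := hy
      simp only [hx', hy', dif_pos] at h
      simpa using e.injective (Subtype.ext h))
  -- b maps A into Pm, and conversely
  have hbA : ∀ x, x ∈ A → b x ∈ Pm := by
    intro x hx
    rw [hb1 x hx]
    simp only [hx, dif_pos]
    exact (e ⟨x, hx⟩).2
  have hbn : ∀ x, b x ∉ Pn → x ∉ Pn := by
    intro x h
    have := b.injective (hb2 _ h)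
    rwa [this] at h
  set w : Equiv.Perm ℕ+ := b * z with hw
  have hwP1 : ∀ x ∈ P1, w x ∈ Pm := by
    intro x hx
    exact hbA _ (Finset.mem_union_right _ (Finset.mem_image_of_mem z hx))
  have hwn : ∀ x, w x ∈ Pn → x ∈ Pn := by
    intro x h
    by_contra h'
    have h1 : z x ∉ Pn := by rwa [hzn]
    have : w x = z x := hb2 _ h1
    rw [this] at h
    exact h1 h
  obtain ⟨a, ha1, ha2⟩ := aux_perm (P1 ∪ (Pn \ Pm)) Pn
    (by
      intro x hx
      simp only [Finset.mem_union, Finset.mem_sdiff, hP1, hPn, hPm] at hx ⊢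
      omega)
    (fun x => if x ∈ Pm then x else w⁻¹ x)
    (by
      intro x hx
      simp only [Finset.mem_union, Finset.mem_sdiff] at hx
      split_ifs with h
      · rw [hPm] at h; rw [hPn]; omega
      · apply hwn
        rcases hx with hx | hx
        · rw [hP1] at hx; rw [hPm] at h; omega
        · simpa using hx.1)
    (by
      have key : ∀ x y : ℕ+, x ∈ P1 ∪ (Pn \ Pm) → x ∈ Pm → y ∉ Pm → x ≠ w⁻¹ y := by
        intro x y hx hxm hy h
        have hx1 : x ∈ P1 := by
          simp only [Finset.mem_union, Finset.mem_sdiff] at hx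
          tauto
        have := hwP1 x hx1
        rw [h] at this
        exact hy (by simpa using this)
      intro x hx y hy h
      have hx' := Finset.mem_coe.1 hx
      have hy' := Finset.mem_coe.1 hy
      dsimp only at h
      split_ifs at h with h1 h2 h2
      · exact h
      · exact absurd h (key x y hx' h1 h2)
      · exact absurd h.symm (key y x hy' h2 h1)
      · exact w⁻¹.injective h)
  refine ⟨a, ⟨fun x hx => ha2 x (by rw [hPn]; omega), fun x hx => ?_⟩,
    b, ⟨fun x hx => hb2 x (by rw [hPn]; omega), fun x hx => ?_⟩, ?_⟩
  · rw [ha1 x (Finset.mem_union_left _ ((hP1 x).2 hx)), if_pos]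
    rw [hPm]; omega
  · have hx2 : x ∈ P2 := (hP2 x).2 hx
    have hxA : x ∈ A := Finset.mem_union_left _ hx2
    rw [hb1 x hxA]
    simp only [hxA, dif_pos]
    exact he ⟨x, hxA⟩ hx2
  · intro x hx
    have hxm : x ∉ Pm := by rw [hPm]; omega
    change w (a x) = x
    by_cases hxn : x ∈ Pn
    · rw [ha1 x (Finset.mem_union_right _ (Finset.mem_sdiff.2 ⟨hxn, hxm⟩)), if_neg hxm]
      simp
    · rw [ha2 x hxn]
      change b (z x) = x
      have h3 : z x = x := hz x (by rw [hPn] at hxn; omega)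
      rw [h3, hb2 x hxn]
end

section
/- Let (λ,δ), (β,γ), (ρ,ν) be proper pairs of partitions. There exist nonnegative rational numbers b_k for |ρ|+|ν| ≤ k ≤ |λ|+|δ|+|β|+|γ|, independent of n (the family being empty, and the sum 0, when |ρ|+|ν| > |λ|+|δ|+|β|+|γ|), such that for every integer n ≥ max(|λ|+|δ|, |β|+|γ|, |ρ|+|ν|) and every ω₀ ∈ B_n of type (ρ,ν)↑n: #{(x,y) ∈ H_{(λ,δ)↑n} × H_{(β,γ)↑n} : x·y = ω₀} = Σ_{k=|ρ|+|ν|}^{|λ|+|δ|+|β|+|γ|} b_k · Π_{t=|ρ|+|ν|}^{k−1} (n−t). In particular this structure coefficient of the center Z(ℂ[B_n]) agrees, for all such n, with a polynomial in n of degree at most |λ|+|δ|+|β|+|γ|−|ρ|−|ν|. -/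
open scoped Classical

/-- The first element `2k-1` (zero-indexed: `2k`) of the pair `p(k) = {2k-1, 2k}`. -/
def pairFst {n : ℕ} (i : Fin n) : Fin (2 * n) := ⟨2 * i.1, by have h := i.2; omega⟩

/-- The second element `2k` (zero-indexed: `2k+1`) of the pair `p(k) = {2k-1, 2k}`. -/
def pairSnd {n : ℕ} (i : Fin n) : Fin (2 * n) := ⟨2 * i.1 + 1, by have h := i.2; omega⟩

/-- Membership in the hyperoctahedral group `B_n ≤ S_{2n}`: every pair `p(i)` is mapped
onto some pair `p(j)`. -/
def IsHyperoct {n : ℕ} (ω : Equiv.Perm (Fin (2 * n))) : Prop :=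
  ∀ i : Fin n, ∃ j : Fin n,
    ({ω (pairFst i), ω (pairSnd i)} : Set (Fin (2 * n))) = {pairFst j, pairSnd j}

/-- The multiset of the lengths of the positive cycles of `ω̄`, for `ω ∈ B_n`.
The cycles of `ω̄` correspond to the orbits of `⟨ω, ε⟩` on `{1,…,2n}` (of size `2ℓ` for a
cycle of length `ℓ`); such a cycle is positive exactly when the `⟨ω⟩`-orbit of each of its
points has size `ℓ`. -/
noncomputable def hyperTypePos (n : ℕ) (ω : Equiv.Perm (Fin (2 * n))) : Multiset ℕ :=
  letI : Fintype (MulAction.orbitRel.Quotient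
      (Subgroup.closure {ω, epsilonPerm n}) (Fin (2 * n))) := Fintype.ofFinite _
  ((Finset.univ : Finset (MulAction.orbitRel.Quotient
      (Subgroup.closure {ω, epsilonPerm n}) (Fin (2 * n)))).val.filter
    (fun o => ∀ x ∈ o.orbit,
      Nat.card (MulAction.orbit (Subgroup.zpowers ω) x) = Nat.card o.orbit / 2)).map
    (fun o => Nat.card o.orbit / 2)

/-- The multiset of the lengths of the negative cycles of `ω̄`, for `ω ∈ B_n`. -/
noncomputable def hyperTypeNeg (n : ℕ) (ω : Equiv.Perm (Fin (2 * n))) : Multiset ℕ :=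
  letI : Fintype (MulAction.orbitRel.Quotient
      (Subgroup.closure {ω, epsilonPerm n}) (Fin (2 * n))) := Fintype.ofFinite _
  ((Finset.univ : Finset (MulAction.orbitRel.Quotient
      (Subgroup.closure {ω, epsilonPerm n}) (Fin (2 * n)))).val.filter
    (fun o => ¬ ∀ x ∈ o.orbit,
      Nat.card (MulAction.orbit (Subgroup.zpowers ω) x) = Nat.card o.orbit / 2)).map
    (fun o => Nat.card o.orbit / 2)

namespace HO

def Good {α : Type} (ε ω : Equiv.Perm α) : Prop :=
  (∀ x, ε (ε x) = x) ∧ (∀ x, ε x ≠ x) ∧ ∀ x, ω (ε x) = ε (ω x)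

noncomputable def key {α : Type} (ε ω : Equiv.Perm α) (x : α) : ℕ × Prop :=
  (Function.minimalPeriod ω x, Equiv.Perm.SameCycle ω x (ε x))

lemma zpow_semi {α β : Type} (j : α → β) (ω : Equiv.Perm α) (ω' : Equiv.Perm β)
    (h : ∀ x, j (ω x) = ω' (j x)) (a : ℤ) (x : α) : j ((ω ^ a) x) = (ω' ^ a) (j x) := by
  have hn : ∀ (n : ℕ) (x : α), j ((ω ^ n) x) = (ω' ^ n) (j x) := by
    intro n
    induction n with
    | zero => intro x; simp
    | succ n ih => intro x; rw [pow_succ, pow_succ]; simp [ih, h]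
  cases a with
  | ofNat n => simpa using hn n x
  | negSucc n =>
    rw [zpow_negSucc, zpow_negSucc, Equiv.Perm.eq_inv_iff_eq, ← hn]
    simp

lemma fix_iff {α : Type} (ω : Equiv.Perm α) (x : α) (a : ℤ) :
    (ω ^ a) x = x ↔ ((Function.minimalPeriod ω x : ℕ) : ℤ) ∣ a :=
  MulAction.zpow_smul_eq_iff_minimalPeriod_dvd (a := ω) (b := x)

lemma key_semi {α β : Type} (j : α → β) (hj : Function.Injective j)
    (ε ω : Equiv.Perm α) (ε' ω' : Equiv.Perm β)
    (h : ∀ x, j (ω x) = ω' (j x)) (h' : ∀ x, j (ε x) = ε' (j x)) (x : α) :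
    key ε' ω' (j x) = key ε ω x := by
  unfold key
  refine Prod.ext ?_ ?_
  · apply Nat.dvd_antisymm
    · rw [← Int.natCast_dvd_natCast, ← fix_iff, ← zpow_semi j ω ω' h, (fix_iff ω x _).2 dvd_rfl]
    · rw [← Int.natCast_dvd_natCast, ← fix_iff]
      apply hj
      rw [zpow_semi j ω ω' h, (fix_iff ω' (j x) _).2 dvd_rfl]
  · apply propext
    constructor
    · rintro ⟨i, hi⟩
      exact ⟨i, hj (by rw [zpow_semi j ω ω' h, h', hi])⟩
    · rintro ⟨i, hi⟩
      exact ⟨i, by rw [← zpow_semi j ω ω' h, hi, h']⟩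

lemma per_pos {α : Type} [Finite α] (ω : Equiv.Perm α) (x : α) :
    0 < Function.minimalPeriod ω x := by
  rw [Nat.pos_iff_ne_zero]
  intro h0
  have := (fix_iff ω x (orderOf ω)).1 (by simp [pow_orderOf_eq_one])
  rw [h0] at this
  have h2 := orderOf_pos ω
  rw [Nat.cast_zero, zero_dvd_iff] at this
  omega

variable {α : Type} {ε ω : Equiv.Perm α}

lemma Good.zpow (hg : Good ε ω) (a : ℤ) (x : α) : (ω ^ a) (ε x) = ε ((ω ^ a) x) :=
  (zpow_semi ε ω ω (fun x => (hg.2.2 x).symm) a x).symm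

lemma Good.key_eps (hg : Good ε ω) (x : α) : key ε ω (ε x) = key ε ω x :=
  key_semi ε ε.injective ε ω ε ω (fun x => (hg.2.2 x).symm) (fun _ => rfl) x

lemma Good.key_zpow (hg : Good ε ω) (a : ℤ) (x : α) : key ε ω ((ω ^ a) x) = key ε ω x :=
  key_semi (ω ^ a) (ω ^ a).injective ε ω ε ω
    (fun x => by rw [← Equiv.Perm.mul_apply, ← Equiv.Perm.mul_apply, zpow_mul_comm_self])
    (fun x => hg.zpow a x) x
  where zpow_mul_comm_self : ω ^ a * ω = ω * ω ^ a := ((Commute.refl ω).zpow_left a).eq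

lemma Good.eps_iff (hg : Good ε ω) (x : α) (a : ℤ) :
    (ω ^ a) x = ε x ↔ (key ε ω x).2 ∧ ((key ε ω x).1 : ℤ) ∣ 2 * a ∧ ¬ ((key ε ω x).1 : ℤ) ∣ a := by
  have key1 : ∀ a : ℤ, (ω ^ a) x = ε x →
      ((key ε ω x).1 : ℤ) ∣ 2 * a ∧ ¬ ((key ε ω x).1 : ℤ) ∣ a := by
    intro a ha
    unfold key
    simp only
    rw [← fix_iff, ← fix_iff]
    refine ⟨?_, ?_⟩
    · rw [two_mul, zpow_add, Equiv.Perm.mul_apply, ha, hg.zpow, ha, hg.1]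
    · rw [ha]; exact hg.2.1 x
  constructor
  · intro ha
    exact ⟨⟨a, ha⟩, key1 a ha⟩
  · rintro ⟨⟨j, hj⟩, h1, h2⟩
    obtain ⟨h3, h4⟩ := key1 j hj
    set m := ((key ε ω x).1 : ℤ) with hm
    have h5 : m ∣ a - j := by
      obtain ⟨u, hu⟩ := h1
      obtain ⟨w, hw⟩ := h3
      have hu' : u % 2 = 1 := by
        by_contra hcon
        obtain ⟨u', rfl⟩ : ∃ u', u = 2 * u' := ⟨u / 2, by omega⟩
        exact h2 ⟨u', by linarith⟩
      have hw' : w % 2 = 1 := by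
        by_contra hcon
        obtain ⟨u', rfl⟩ : ∃ u', w = 2 * u' := ⟨w / 2, by omega⟩
        exact h4 ⟨u', by linarith⟩
      obtain ⟨t, ht⟩ : ∃ t, u - w = 2 * t := ⟨(u - w) / 2, by omega⟩
      refine ⟨t, ?_⟩
      have : m * (u - w) = m * (2 * t) := by rw [ht]
      linarith
    have h6 := (fix_iff ω x (a - j)).2 h5
    have : a = j + (a - j) := by ring
    rw [this, zpow_add, Equiv.Perm.mul_apply, h6, hj]

lemma Good.even (hg : Good ε ω) (x : α) (h : (key ε ω x).2) : 2 ∣ (key ε ω x).1 := by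
  obtain ⟨j, hj⟩ := h
  obtain ⟨-, ⟨u, hu⟩, h4⟩ := (hg.eps_iff x j).1 hj
  by_contra hodd
  apply h4
  have : Int.gcd ((key ε ω x).1 : ℤ) 2 = 1 := by
    rw [show (2:ℤ) = ((2:ℕ):ℤ) from rfl, Int.gcd_natCast_natCast]
    exact ((Nat.coprime_primes_iff_odd _).2 hodd)
  exact Int.dvd_of_dvd_mul_right_of_gcd_one ⟨u, hu⟩ this
  where Nat.coprime_primes_iff_odd (m : ℕ) : m.Coprime 2 ↔ ¬ 2 ∣ m := by
          rw [Nat.coprime_comm]; exact Nat.Prime.coprime_iff_not_dvd Nat.prime_two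

lemma Good.mem_orbit (hg : Good ε ω) (x y : α) :
    y ∈ MulAction.orbit (Subgroup.closure {ω, ε}) x ↔
      (∃ a : ℤ, y = (ω ^ a) x) ∨ ∃ a : ℤ, y = (ω ^ a) (ε x) := by
  constructor
  · rintro ⟨⟨g, hgm⟩, rfl⟩
    show (∃ a : ℤ, g x = (ω ^ a) x) ∨ ∃ a : ℤ, g x = (ω ^ a) (ε x)
    have : (∃ a : ℤ, g = ω ^ a) ∨ ∃ a : ℤ, g = ω ^ a * ε := by
      have hcom : Commute ω ε := Equiv.ext fun x => hg.2.2 x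
      have he2 : ε * ε = 1 := Equiv.ext fun x => hg.1 x
      have hei : ε⁻¹ = ε := by rw [inv_eq_iff_mul_eq_one, he2]
      refine Subgroup.closure_induction (p := fun g _ =>
        (∃ a : ℤ, g = ω ^ a) ∨ ∃ a : ℤ, g = ω ^ a * ε) ?_ ?_ ?_ ?_ hgm
      · rintro z (rfl | rfl)
        · exact Or.inl ⟨1, by simp⟩
        · exact Or.inr ⟨0, by simp⟩
      · exact Or.inl ⟨0, by simp⟩
      · rintro u v - - (⟨a, rfl⟩ | ⟨a, rfl⟩) (⟨b, rfl⟩ | ⟨b, rfl⟩)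
        · exact Or.inl ⟨a + b, (zpow_add _ _ _).symm⟩
        · exact Or.inr ⟨a + b, by rw [zpow_add, mul_assoc]⟩
        · exact Or.inr ⟨a + b, by rw [zpow_add, mul_assoc, mul_assoc, (hcom.zpow_left b).eq]⟩
        · exact Or.inl ⟨a + b, by
            rw [zpow_add, mul_assoc, ← mul_assoc ε, ← (hcom.zpow_left b).eq, mul_assoc _ ε ε, he2, mul_one]⟩
      · rintro u - (⟨a, rfl⟩ | ⟨a, rfl⟩)
        · exact Or.inl ⟨-a, by simp⟩
        · exact Or.inr ⟨-a, by rw [mul_inv_rev, hei, zpow_neg, ← zpow_neg, (hcom.zpow_left (-a)).eq]⟩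
    rcases this with ⟨a, rfl⟩ | ⟨a, rfl⟩
    · exact Or.inl ⟨a, rfl⟩
    · exact Or.inr ⟨a, rfl⟩
  · have hω : ω ∈ Subgroup.closure {ω, ε} := Subgroup.subset_closure (by simp)
    have hε : ε ∈ Subgroup.closure {ω, ε} := Subgroup.subset_closure (by simp)
    rintro (⟨a, rfl⟩ | ⟨a, rfl⟩)
    · exact ⟨⟨ω ^ a, Subgroup.zpow_mem _ hω a⟩, rfl⟩
    · exact ⟨⟨ω ^ a * ε, Subgroup.mul_mem _ (Subgroup.zpow_mem _ hω a) hε⟩, rfl⟩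

lemma Good.key_orbit (hg : Good ε ω) {x y : α}
    (h : y ∈ MulAction.orbit (Subgroup.closure {ω, ε}) x) : key ε ω y = key ε ω x := by
  rcases (hg.mem_orbit x y).1 h with ⟨a, rfl⟩ | ⟨a, rfl⟩
  · exact hg.key_zpow a x
  · rw [hg.key_zpow, hg.key_eps]

lemma card_zorbit [Finite α] (ω : Equiv.Perm α) (x : α) :
    Nat.card (MulAction.orbit (Subgroup.zpowers ω) x) = Function.minimalPeriod ω x := by
  let _ : Fintype (MulAction.orbit (Subgroup.zpowers ω) x) := Fintype.ofFinite _
  rw [Nat.card_eq_fintype_card]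
  exact (MulAction.minimalPeriod_eq_card ω x).symm

lemma mem_zorbit (ω : Equiv.Perm α) (x y : α) :
    y ∈ MulAction.orbit (Subgroup.zpowers ω) x ↔ ∃ a : ℤ, y = (ω ^ a) x := by
  constructor
  · rintro ⟨⟨g, a, rfl⟩, rfl⟩
    exact ⟨a, rfl⟩
  · rintro ⟨a, rfl⟩
    exact ⟨⟨ω ^ a, a, rfl⟩, rfl⟩

lemma Good.card_orbit [Finite α] (hg : Good ε ω) (x : α) :
    Nat.card (MulAction.orbit (Subgroup.closure {ω, ε}) x) =
      if (key ε ω x).2 then (key ε ω x).1 else 2 * (key ε ω x).1 := by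
  have hU : MulAction.orbit (Subgroup.closure {ω, ε}) x =
      MulAction.orbit (Subgroup.zpowers ω) x ∪ MulAction.orbit (Subgroup.zpowers ω) (ε x) := by
    ext y
    rw [Set.mem_union, mem_zorbit, mem_zorbit, hg.mem_orbit]
  have hp : Function.minimalPeriod ω (ε x) = (key ε ω x).1 := congrArg Prod.fst (hg.key_eps x)
  split_ifs with h
  · have : MulAction.orbit (Subgroup.zpowers ω) (ε x) = MulAction.orbit (Subgroup.zpowers ω) x := by
      rw [MulAction.orbit_eq_iff, mem_zorbit]
      obtain ⟨a, ha⟩ := h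
      exact ⟨a, ha.symm⟩
    rw [hU, this, Set.union_self, card_zorbit]
    rfl
  · rw [hU, Nat.card_coe_set_eq, Set.ncard_union_eq, ← Nat.card_coe_set_eq, ← Nat.card_coe_set_eq,
      card_zorbit, card_zorbit, hp, two_mul]
    · rfl
    · rw [Set.disjoint_left]
      intro y h1 h2
      rw [mem_zorbit] at h1 h2
      obtain ⟨a, rfl⟩ := h1
      obtain ⟨b, hb⟩ := h2
      apply h
      refine ⟨-b + a, ?_⟩
      rw [zpow_add, Equiv.Perm.mul_apply, hb, zpow_neg]; simp

/-- half orbit size and sign -/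
noncomputable def lk (v : ℕ × Prop) : ℕ := if v.2 then v.1 / 2 else v.1

lemma Good.card_orbit' [Finite α] (hg : Good ε ω) (x : α) :
    Nat.card (MulAction.orbit (Subgroup.closure {ω, ε}) x) = 2 * lk (key ε ω x) := by
  rw [hg.card_orbit, lk]
  split_ifs with h
  · have := hg.even x h; omega
  · rfl

lemma Good.lk_pos [Finite α] (hg : Good ε ω) (x : α) : 0 < lk (key ε ω x) := by
  have h1 : 0 < (key ε ω x).1 := per_pos ω x
  unfold lk
  split_ifs with h
  · have := hg.even x h; omega
  · exact h1

abbrev QQ (ε ω : Equiv.Perm α) : Type := MulAction.orbitRel.Quotient (Subgroup.closure {ω, ε}) α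

noncomputable instance [Finite α] : Fintype (QQ ε ω) := Fintype.ofFinite _

def qm (ε ω : Equiv.Perm α) (x : α) : QQ ε ω := Quotient.mk'' x

noncomputable def qo (o : QQ ε ω) : α := Quotient.out o

lemma qm_qo (o : QQ ε ω) : qm ε ω (qo o) = o := Quotient.out_eq' o

lemma qm_eq (x y : α) : qm ε ω x = qm ε ω y ↔
    x ∈ MulAction.orbit (Subgroup.closure {ω, ε}) y := by
  unfold qm
  rw [Quotient.eq'']
  exact MulAction.orbitRel_apply

noncomputable def kq (o : QQ ε ω) : ℕ × Prop := key ε ω (qo o)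

lemma Good.kq_qm (hg : Good ε ω) (x : α) : kq (qm ε ω x) = key ε ω x :=
  hg.key_orbit ((qm_eq _ _).1 (qm_qo _))

lemma orbit_qo (o : QQ ε ω) : o.orbit = MulAction.orbit (Subgroup.closure {ω, ε}) (qo o) := by
  conv_lhs => rw [← qm_qo o]
  exact MulAction.orbitRel.Quotient.orbit_mk _

lemma Good.card_qorbit [Finite α] (hg : Good ε ω) (o : QQ ε ω) :
    Nat.card o.orbit = 2 * lk (kq o) := by
  rw [orbit_qo, hg.card_orbit']; rfl

lemma Good.count [Fintype α] (hg : Good ε ω) (p : ℕ × Prop → Prop) :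
    (Finset.univ.filter (fun x : α => p (key ε ω x))).card =
      ∑ o ∈ Finset.univ.filter (fun o : QQ ε ω => p (kq o)), 2 * lk (kq o) := by
  rw [Finset.card_eq_sum_card_fiberwise (f := qm ε ω)
    (t := Finset.univ.filter (fun o : QQ ε ω => p (kq o)))]
  · apply Finset.sum_congr rfl
    intro o ho
    rw [← hg.card_qorbit, Nat.card_coe_set_eq, Set.ncard_eq_toFinset_card']
    congr 1
    ext x
    simp only [Finset.mem_filter, Finset.mem_univ, true_and, Set.mem_toFinset] at ho ⊢
    rw [MulAction.orbitRel.Quotient.mem_orbit]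
    change _ ∧ _ ↔ qm ε ω x = o
    constructor
    · exact fun h => h.2
    · rintro rfl
      rw [hg.kq_qm] at ho
      exact ⟨ho, rfl⟩
  · intro x hx
    simp only [Finset.coe_filter, Finset.mem_univ, true_and, Set.mem_ofPred_eq] at hx ⊢
    rwa [hg.kq_qm]

noncomputable def TP [Finite α] (ε ω : Equiv.Perm α) : Multiset ℕ :=
  ((Finset.univ : Finset (QQ ε ω)).val.filter
    (fun o => ∀ x ∈ o.orbit,
      Nat.card (MulAction.orbit (Subgroup.zpowers ω) x) = Nat.card o.orbit / 2)).map
    (fun o => Nat.card o.orbit / 2)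

noncomputable def TN [Finite α] (ε ω : Equiv.Perm α) : Multiset ℕ :=
  ((Finset.univ : Finset (QQ ε ω)).val.filter
    (fun o => ¬ ∀ x ∈ o.orbit,
      Nat.card (MulAction.orbit (Subgroup.zpowers ω) x) = Nat.card o.orbit / 2)).map
    (fun o => Nat.card o.orbit / 2)

lemma hp_eq (n : ℕ) (ω : Equiv.Perm (Fin (2 * n))) :
    hyperTypePos n ω = TP (epsilonPerm n) ω := by
  unfold hyperTypePos TP
  congr!

lemma hn_eq (n : ℕ) (ω : Equiv.Perm (Fin (2 * n))) :
    hyperTypeNeg n ω = TN (epsilonPerm n) ω := by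
  unfold hyperTypeNeg TN
  congr!

lemma Good.pos_iff [Finite α] (hg : Good ε ω) (o : QQ ε ω) :
    (∀ x ∈ o.orbit,
      Nat.card (MulAction.orbit (Subgroup.zpowers ω) x) = Nat.card o.orbit / 2) ↔ ¬ (kq o).2 := by
  have h1 : ∀ x ∈ o.orbit, Nat.card (MulAction.orbit (Subgroup.zpowers ω) x) = (kq o).1 := by
    intro x hx
    rw [orbit_qo] at hx
    rw [card_zorbit]
    exact congrArg Prod.fst (hg.key_orbit hx)
  have h2 : lk (kq o) = (kq o).1 ↔ ¬ (kq o).2 := by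
    have := hg.lk_pos (qo o)
    change 0 < lk (kq o) at this
    unfold lk at *
    by_cases h : (kq o).2
    · rw [if_pos h] at *
      constructor
      · intro h'; omega
      · exact fun h' => absurd h h'
    · rw [if_neg h]
      exact ⟨fun _ => h, fun _ => rfl⟩
  rw [hg.card_qorbit, ← h2, Nat.mul_div_cancel_left _ (by norm_num : 0 < 2)]
  constructor
  · intro h
    have hm : qo o ∈ o.orbit := by rw [orbit_qo]; exact MulAction.mem_orbit_self _
    rw [← h _ hm, h1 _ hm]
  · intro h x hx
    rw [h1 x hx, h]

lemma Good.TP_eq [Finite α] (hg : Good ε ω) : TP ε ω =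
    ((Finset.univ : Finset (QQ ε ω)).val.filter (fun o => ¬ (kq o).2)).map
      (fun o => lk (kq o)) := by
  unfold TP
  simp only [hg.pos_iff]
  simp only [hg.card_qorbit, Nat.mul_div_cancel_left _ (by norm_num : 0 < 2)]

lemma Good.TN_eq [Finite α] (hg : Good ε ω) : TN ε ω =
    ((Finset.univ : Finset (QQ ε ω)).val.filter (fun o => ¬¬ (kq o).2)).map
      (fun o => lk (kq o)) := by
  unfold TN
  simp only [hg.pos_iff]
  simp only [hg.card_qorbit, Nat.mul_div_cancel_left _ (by norm_num : 0 < 2)]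

lemma Good.sum_eq [Fintype α] (hg : Good ε ω) :
    2 * ((TP ε ω).sum + (TN ε ω).sum) = Fintype.card α := by
  rw [hg.TP_eq, hg.TN_eq, ← Multiset.sum_add, ← Multiset.map_add, Multiset.filter_add_not]
  have := hg.count (fun _ => True)
  simp only [Finset.filter_true] at this
  rw [← Finset.card_univ, this, ← Finset.mul_sum]
  rfl

noncomputable def cnt [Fintype α] (ε ω : Equiv.Perm α) (v : ℕ × Prop) : ℕ :=
  (Finset.univ.filter (fun x : α => key ε ω x = v)).card

lemma Good.cnt_eq [Fintype α] (hg : Good ε ω) (v : ℕ × Prop) :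
    cnt ε ω v = 2 * lk v * (Finset.univ.filter (fun o : QQ ε ω => kq o = v)).card := by
  unfold cnt
  have h := hg.count (fun w => w = v)
  rw [Finset.sum_congr rfl (g := fun _ => 2 * lk v)] at h
  · rw [Finset.sum_const, smul_eq_mul, mul_comm] at h
    convert h
  · intro o ho
    simp only [Finset.mem_filter] at ho
    rw [ho.2]

lemma Good.cntP [Fintype α] (hg : Good ε ω) (l : ℕ) :
    cnt ε ω (l, False) = 2 * l * (TP ε ω).count l := by
  rw [hg.cnt_eq, hg.TP_eq, Multiset.count_map, Multiset.filter_filter]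
  have : lk (l, False) = l := by simp [lk]
  rw [this]
  congr 1
  change Multiset.card (Multiset.filter _ _) = _
  congr 1
  apply Multiset.filter_congr
  intro o _
  have : kq o = ((kq o).1, (kq o).2) := rfl
  rw [Prod.ext_iff]
  simp only [lk, eq_iff_iff, iff_false]
  constructor
  · rintro ⟨h1, h2⟩; simp [h1, h2]
  · rintro ⟨h1, h2⟩; rw [if_neg h2] at h1; exact ⟨h1.symm, h2⟩

lemma Good.cntN [Fintype α] (hg : Good ε ω) (l : ℕ) :
    cnt ε ω (2 * l, True) = 2 * l * (TN ε ω).count l := by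
  rw [hg.cnt_eq, hg.TN_eq, Multiset.count_map, Multiset.filter_filter]
  have : lk (2 * l, True) = l := by simp [lk]
  rw [this]
  congr 1
  change Multiset.card (Multiset.filter _ _) = _
  congr 1
  apply Multiset.filter_congr
  intro o _
  rw [Prod.ext_iff]
  simp only [lk, eq_iff_iff, iff_true, not_not]
  constructor
  · rintro ⟨h1, h2⟩; simp [h1, h2]
  · rintro ⟨h1, h2⟩; rw [if_pos h2] at h1
    have : 2 ∣ (kq o).1 := hg.even _ h2
    exact ⟨by omega, h2⟩

lemma Good.TP_zero [Finite α] (hg : Good ε ω) : 0 ∉ TP ε ω := by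
  rw [hg.TP_eq]
  simp only [Multiset.mem_map, not_exists, not_and]
  intro o _ h
  have := hg.lk_pos (qo o)
  change 0 < lk (kq o) at this
  omega

lemma Good.TN_zero [Finite α] (hg : Good ε ω) : 0 ∉ TN ε ω := by
  rw [hg.TN_eq]
  simp only [Multiset.mem_map, not_exists, not_and]
  intro o _ h
  have := hg.lk_pos (qo o)
  change 0 < lk (kq o) at this
  omega

/-- the stable form of having a given type -/
def CC [Fintype α] (lam del : Multiset ℕ) (ε ω : Equiv.Perm α) : Prop :=
  (∀ l, 2 ≤ l → cnt ε ω (l, False) = 2 * l * lam.count l) ∧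
  ∀ l, cnt ε ω (2 * l, True) = 2 * l * del.count l

lemma Good.type_iff [Fintype α] (hg : Good ε ω) (lam del : Multiset ℕ) (n : ℕ)
    (hlam : ∀ p ∈ lam, 2 ≤ p) (hdel : ∀ p ∈ del, 1 ≤ p)
    (hc : Fintype.card α = 2 * n) :
    (TP ε ω = lam + Multiset.replicate (n - lam.sum - del.sum) 1 ∧ TN ε ω = del) ↔
      CC lam del ε ω := by
  constructor
  · rintro ⟨h1, h2⟩
    refine ⟨fun l hl => ?_, fun l => ?_⟩
    · rw [hg.cntP, h1, Multiset.count_add, Multiset.count_replicate, if_neg (by omega), add_zero]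
    · rw [hg.cntN, h2]
  · rintro ⟨h1, h2⟩
    have hN : TN ε ω = del := by
      ext l
      rcases Nat.eq_zero_or_pos l with rfl | hl
      · rw [Multiset.count_eq_zero_of_notMem hg.TN_zero, Multiset.count_eq_zero_of_notMem]
        intro h; have := hdel _ h; omega
      · have := h2 l
        rw [hg.cntN] at this
        exact Nat.eq_of_mul_eq_mul_left (by omega) this
    have hP : TP ε ω = lam + Multiset.replicate ((TP ε ω).count 1) 1 := by
      ext l
      rw [Multiset.count_add, Multiset.count_replicate]
      rcases Nat.eq_zero_or_pos l with rfl | hl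
      · rw [Multiset.count_eq_zero_of_notMem hg.TP_zero, Multiset.count_eq_zero_of_notMem]
        · simp
        · intro h; have := hlam _ h; omega
      · by_cases h : 1 = l
        · subst h
          rw [Multiset.count_eq_zero_of_notMem (s := lam)]
          · simp
          · intro h; have := hlam _ h; omega
        · have := h1 l (by omega)
          rw [hg.cntP] at this
          rw [if_neg h, add_zero]
          exact Nat.eq_of_mul_eq_mul_left (by omega) this
    refine ⟨?_, hN⟩
    have hs := hg.sum_eq
    rw [hN, hc] at hs
    have h3 := congrArg Multiset.sum hP
    rw [Multiset.sum_add, Multiset.sum_replicate] at h3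
    simp only [smul_eq_mul, mul_one] at h3
    have : (TP ε ω).count 1 = n - lam.sum - del.sum := by omega
    rw [this] at hP
    exact hP

/-- number of fixed points -/
lemma Good.fixed [Fintype α] (hg : Good ε ω) (lam del : Multiset ℕ) (n : ℕ)
    (hlam : ∀ p ∈ lam, 2 ≤ p) (hdel : ∀ p ∈ del, 1 ≤ p)
    (hc : Fintype.card α = 2 * n) (hn : lam.sum + del.sum ≤ n) (h : CC lam del ε ω) :
    (Finset.univ.filter (fun x : α => ω x ≠ x)).card = 2 * (lam.sum + del.sum) := by
  obtain ⟨h1, h2⟩ := (hg.type_iff lam del n hlam hdel hc).2 h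
  have h3 := hg.cntP 1
  have h4 : cnt ε ω (1, False) = (Finset.univ.filter (fun x : α => ω x = x)).card := by
    unfold cnt
    congr 1
    ext x
    simp only [Finset.mem_filter, Finset.mem_univ, true_and]
    unfold key
    rw [Prod.ext_iff]
    simp only [Function.minimalPeriod_eq_one_iff_isFixedPt, eq_iff_iff, iff_false]
    constructor
    · exact fun h => h.1
    · intro h
      refine ⟨h, ?_⟩
      rintro ⟨i, hi⟩
      rw [(Equiv.Perm.zpow_apply_eq_self_of_apply_eq_self h i)] at hi
      exact hg.2.1 x hi.symm
  have h5 := Finset.card_filter_add_card_filter_not (s := (Finset.univ : Finset α)) (fun x : α => ω x = x)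
  rw [Finset.card_univ, hc, ← h4, h3, h1, Multiset.count_add, Multiset.count_replicate_self,
    Multiset.count_eq_zero_of_notMem (s := lam)] at h5
  · simp only [ne_eq]; omega
  · intro h; have := hlam _ h; omega

def pw (ε ω : Equiv.Perm α) (a : ℤ) (b : Bool) (r : α) : α :=
  (ω ^ a) (match b with | true => ε r | false => r)

lemma Good.qm_pw (hg : Good ε ω) (a : ℤ) (b : Bool) (r : α) :
    qm ε ω (pw ε ω a b r) = qm ε ω r := by
  rw [qm_eq, hg.mem_orbit]
  cases b
  · exact Or.inl ⟨a, rfl⟩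
  · exact Or.inr ⟨a, rfl⟩

lemma Good.exists_pw (hg : Good ε ω) (x : α) :
    ∃ (a : ℤ) (b : Bool), pw ε ω a b (qo (qm ε ω x)) = x := by
  have h : x ∈ MulAction.orbit (Subgroup.closure {ω, ε}) (qo (qm ε ω x)) :=
    (qm_eq _ _).1 (qm_qo _).symm
  rcases (hg.mem_orbit _ _).1 h with ⟨a, h⟩ | ⟨a, h⟩
  · exact ⟨a, false, h.symm⟩
  · exact ⟨a, true, h.symm⟩

lemma zpow_eq_iff (ω : Equiv.Perm α) (a c : ℤ) (x y : α) :
    (ω ^ a) x = (ω ^ c) y ↔ (ω ^ (a - c)) x = y := by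
  rw [sub_eq_neg_add, zpow_add, Equiv.Perm.mul_apply, zpow_neg, Equiv.Perm.inv_eq_iff_eq]

lemma Good.pw_iff (hg : Good ε ω) (a c : ℤ) (b d : Bool) (r : α) :
    pw ε ω a b r = pw ε ω c d r ↔
      if b = d then ((key ε ω r).1 : ℤ) ∣ (a - c) else
        ((key ε ω r).2 ∧ ((key ε ω r).1 : ℤ) ∣ 2 * (a - c) ∧ ¬ ((key ε ω r).1 : ℤ) ∣ (a - c)) := by
  cases b <;> cases d <;> simp only [pw, zpow_eq_iff]
  · rw [if_pos trivial]; exact fix_iff ω r _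
  · rw [if_neg (by simp)]; exact hg.eps_iff r _
  · rw [if_neg (by simp)]
    have h := hg.eps_iff (ε r) (a - c)
    rw [hg.key_eps, hg.1] at h
    exact h
  · rw [if_pos trivial, ← hg.key_eps r]; exact fix_iff ω (ε r) _

lemma pw_omega (a : ℤ) (b : Bool) (r : α) :
    ω (pw ε ω a b r) = pw ε ω (1 + a) b r := by
  unfold pw
  rw [zpow_add, zpow_one, Equiv.Perm.mul_apply]

lemma Good.pw_eps (hg : Good ε ω) (a : ℤ) (b : Bool) (r : α) :
    ε (pw ε ω a b r) = pw ε ω a (!b) r := by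
  unfold pw
  rw [← hg.zpow]
  cases b
  · rfl
  · simp [hg.1]

lemma exists_conj {β : Type} [Fintype α] [Fintype β] {ε' ω' : Equiv.Perm β}
    (hg : Good ε ω) (hg' : Good ε' ω') (hc : Fintype.card α = Fintype.card β)
    (h : ∀ v, cnt ε ω v = cnt ε' ω' v) :
    ∃ e : α ≃ β, (∀ x, e (ω x) = ω' (e x)) ∧ ∀ x, e (ε x) = ε' (e x) := by
  have h1 : ∀ v, Nonempty ({o : QQ ε ω // kq o = v} ≃ {o : QQ ε' ω' // kq o = v}) := by
    intro v
    rw [← Fintype.card_eq, Fintype.card_subtype, Fintype.card_subtype]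
    rcases Nat.eq_zero_or_pos (lk v) with h0 | h0
    · rw [Finset.card_eq_zero.2, Finset.card_eq_zero.2]
      · rw [Finset.filter_eq_empty_iff]
        rintro o - rfl
        exact (hg'.lk_pos (qo o)).ne' h0
      · rw [Finset.filter_eq_empty_iff]
        rintro o - rfl
        exact (hg.lk_pos (qo o)).ne' h0
    · have h2 := h v
      rw [hg.cnt_eq, hg'.cnt_eq] at h2
      have h3 := Nat.eq_of_mul_eq_mul_left (by omega) h2
      convert h3
  let σ : QQ ε ω ≃ QQ ε' ω' := Equiv.ofFiberEquiv (fun v => (h1 v).some)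
  have hσ : ∀ o, kq (σ o) = kq o := fun o => Equiv.ofFiberEquiv_map _ o
  choose a b hab using hg.exists_pw
  let f : α → β := fun x => pw ε' ω' (a x) (b x) (qo (σ (qm ε ω x)))
  have tr : ∀ (o : QQ ε ω) (a c : ℤ) (b d : Bool), pw ε ω a b (qo o) = pw ε ω c d (qo o) ↔
      pw ε' ω' a b (qo (σ o)) = pw ε' ω' c d (qo (σ o)) := by
    intro o a c b d
    rw [hg.pw_iff, hg'.pw_iff]
    have h4 := hσ o
    unfold kq at h4
    rw [h4]
  have hf : ∀ (o : QQ ε ω) (c : ℤ) (d : Bool),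
      f (pw ε ω c d (qo o)) = pw ε' ω' c d (qo (σ o)) := by
    intro o c d
    have h5 : qm ε ω (pw ε ω c d (qo o)) = o := by rw [hg.qm_pw, qm_qo]
    have h6 := hab (pw ε ω c d (qo o))
    rw [h5] at h6
    simp only [f]
    rw [h5, ← tr]
    exact h6
  have hinj : Function.Injective f := by
    intro x y hxy
    have h7 : ∀ x, qm ε' ω' (f x) = σ (qm ε ω x) := by
      intro x
      simp only [f]
      rw [hg'.qm_pw, qm_qo]
    have h8 : qm ε ω x = qm ε ω y := σ.injective (by rw [← h7, ← h7, hxy])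
    rw [← hab x, ← hab y, h8, tr, ← hf, ← hf]
    rw [hab y, ← h8, hab x, hxy]
  have hbij : Function.Bijective f := (Fintype.bijective_iff_injective_and_card f).2 ⟨hinj, hc⟩
  refine ⟨Equiv.ofBijective f hbij, ?_, ?_⟩
  · intro x
    show f (ω x) = ω' (f x)
    rw [← hab x, pw_omega, hf, hf, pw_omega]
  · intro x
    show f (ε x) = ε' (f x)
    rw [← hab x, hg.pw_eps, hf, hf, hg'.pw_eps]

lemma exists_conj' {β : Type} [Fintype α] [Fintype β] {ε' ω' : Equiv.Perm β}
    (rho nu : Multiset ℕ)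
    (hrho : ∀ p ∈ rho, 2 ≤ p) (hnu : ∀ p ∈ nu, 1 ≤ p)
    (hg : Good ε ω) (hg' : Good ε' ω') (hc : Fintype.card α = Fintype.card β)
    (h : CC rho nu ε ω) (h' : CC rho nu ε' ω') :
    ∃ e : α ≃ β, (∀ x, e (ω x) = ω' (e x)) ∧ ∀ x, e (ε x) = ε' (e x) := by
  apply exists_conj hg hg' hc
  obtain ⟨h1, h2⟩ := (hg.type_iff rho nu _ hrho hnu hg.sum_eq.symm).2 h
  obtain ⟨h3, h4⟩ := (hg'.type_iff rho nu _ hrho hnu (hc ▸ hg.sum_eq.symm)).2 h'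
  rintro ⟨m, P⟩
  rcases Classical.propComplete P with rfl | rfl
  · rcases Nat.even_or_odd' m with ⟨l, rfl | rfl⟩
    · rw [hg.cntN, hg'.cntN, h2, h4]
    · have : ∀ {γ : Type} [Fintype γ] {ε ω : Equiv.Perm γ}, Good ε ω →
          cnt ε ω (2 * l + 1, True) = 0 := by
        intro γ _ ε ω hg
        unfold cnt
        rw [Finset.card_eq_zero, Finset.filter_eq_empty_iff]
        intro x _ hx
        have := hg.even x (by rw [hx]; trivial)
        rw [hx] at this
        simp only at this
        omega
      rw [this hg, this hg']
  · rw [hg.cntP, hg'.cntP, h1, h3]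

lemma cnt_semi {β : Type} [Fintype α] [Fintype β] {ε' ω' : Equiv.Perm β}
    (j : α → β) (hj : Function.Injective j)
    (h : ∀ x, j (ω x) = ω' (j x)) (h' : ∀ x, j (ε x) = ε' (j x))
    (hε : ∀ y, ε' y ≠ y) (hfix : ∀ y, y ∉ Set.range j → ω' y = y)
    (v : ℕ × Prop) (hv : v ≠ (1, False)) : cnt ε' ω' v = cnt ε ω v := by
  unfold cnt
  rw [← Finset.card_image_of_injective _ hj]
  congr 1
  ext y
  simp only [Finset.mem_filter, Finset.mem_univ, true_and, Finset.mem_image]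
  constructor
  · intro hy
    by_cases hr : y ∈ Set.range j
    · obtain ⟨x, rfl⟩ := hr
      exact ⟨x, by rwa [key_semi j hj ε ω ε' ω' h h'] at hy, rfl⟩
    · exfalso
      apply hv
      rw [← hy]
      have h0 := hfix y hr
      unfold key
      refine Prod.ext (Function.minimalPeriod_eq_one_iff_isFixedPt.2 h0) ?_
      simp only [eq_iff_iff, iff_false]
      rintro ⟨i, hi⟩
      rw [(Equiv.Perm.zpow_apply_eq_self_of_apply_eq_self h0 i)] at hi
      exact hε y hi.symm
  · rintro ⟨x, hx, rfl⟩
    rw [key_semi j hj ε ω ε' ω' h h', hx]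

lemma CC_semi {β : Type} [Fintype α] [Fintype β] {ε' ω' : Equiv.Perm β}
    (j : α → β) (hj : Function.Injective j)
    (h : ∀ x, j (ω x) = ω' (j x)) (h' : ∀ x, j (ε x) = ε' (j x))
    (hε : ∀ y, ε' y ≠ y) (hfix : ∀ y, y ∉ Set.range j → ω' y = y)
    (lam del : Multiset ℕ) : CC lam del ε' ω' ↔ CC lam del ε ω := by
  have key := cnt_semi j hj h h' hε hfix
  unfold CC
  refine and_congr ?_ ?_
  · refine forall_congr' fun l => forall_congr' fun hl => ?_
    rw [key]
    intro hc
    have := congrArg Prod.fst hc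
    simp only at this
    omega
  · refine forall_congr' fun l => ?_
    rw [key]
    intro hc
    have := congrArg Prod.snd hc
    simp at this

def PP [Fintype α] (lam del beta gam : Multiset ℕ) (ε ω : Equiv.Perm α) (S : α → Prop)
    (p : Equiv.Perm α × Equiv.Perm α) : Prop :=
  Good ε p.1 ∧ CC lam del ε p.1 ∧ Good ε p.2 ∧ CC beta gam ε p.2 ∧ p.1 * p.2 = ω ∧
    ∀ t, (p.1 t ≠ t ∨ p.2 t ≠ t) ↔ S t

noncomputable def FF [Fintype α] (lam del beta gam : Multiset ℕ) (ε ω : Equiv.Perm α)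
    (S : α → Prop) : ℕ := Nat.card {p // PP lam del beta gam ε ω S p}

lemma Good_permCongr {β : Type} (e : α ≃ β) (ε ω : Equiv.Perm α) :
    Good (e.permCongr ε) (e.permCongr ω) ↔ Good ε ω := by
  unfold Good
  simp only [Equiv.permCongr_apply, e.symm.forall_congr_left]
  simp [← Equiv.eq_symm_apply]

lemma CC_permCongr {β : Type} [Fintype α] [Fintype β] (e : α ≃ β) (ε ω : Equiv.Perm α)
    (hε : ∀ y, ε y ≠ y) (lam del : Multiset ℕ) :
    CC lam del (e.permCongr ε) (e.permCongr ω) ↔ CC lam del ε ω := by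
  apply CC_semi e e.injective
  · intro x; simp [Equiv.permCongr_apply]
  · intro x; simp [Equiv.permCongr_apply]
  · intro y hy
    rw [Equiv.permCongr_apply, ← Equiv.eq_symm_apply] at hy
    exact hε _ hy
  · intro y hy
    exact absurd ⟨e.symm y, by simp⟩ hy

lemma FF_permCongr {β : Type} [Fintype α] [Fintype β] (lam del beta gam : Multiset ℕ)
    (e : α ≃ β) (ε ω : Equiv.Perm α) (hε : ∀ y, ε y ≠ y) :
    FF lam del beta gam (e.permCongr ε) (e.permCongr ω) (fun _ => True) =
      FF lam del beta gam ε ω (fun _ => True) := by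
  refine (Nat.card_congr (Equiv.subtypeEquiv (e.permCongr.prodCongr e.permCongr) ?_)).symm
  rintro ⟨x, y⟩
  simp only [PP, Equiv.prodCongr_apply, Prod.map]
  rw [Good_permCongr, Good_permCongr, CC_permCongr e ε x hε, CC_permCongr e ε y hε,
    ← Equiv.permCongr_mul, e.permCongr.injective.eq_iff, e.symm.forall_congr_left]
  simp [Equiv.permCongr_apply]

lemma FF_restrict [Fintype α] (lam del beta gam : Multiset ℕ) (hg : Good ε ω)
    (S : α → Prop) (hS : ∀ x, S (ε x) ↔ S x) (hS' : ∀ x, S (ω x) ↔ S x)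
    (hω : ∀ x, ω x ≠ x → S x) :
    FF lam del beta gam ε ω S = FF lam del beta gam (ε.subtypePerm hS) (ω.subtypePerm hS')
      (fun _ => True) := by
  have hG : ∀ u : Equiv.Perm (Subtype S), Good ε (Equiv.Perm.ofSubtype u) ↔
      Good (ε.subtypePerm hS) u := by
    intro u
    constructor
    · rintro ⟨h1, h2, h3⟩
      refine ⟨fun x => Subtype.ext (h1 x), fun x hx => h2 x (congrArg Subtype.val hx), ?_⟩
      intro x
      apply Subtype.ext
      have := h3 x
      rw [Equiv.Perm.ofSubtype_apply_coe] at this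
      rw [← Equiv.Perm.ofSubtype_apply_coe]
      exact this
    · rintro ⟨h1, h2, h3⟩
      refine ⟨hg.1, hg.2.1, ?_⟩
      intro x
      by_cases hx : S x
      · have := congrArg Subtype.val (h3 ⟨x, hx⟩)
        rw [← Equiv.Perm.ofSubtype_apply_coe] at this
        rw [Equiv.Perm.ofSubtype_apply_of_mem u hx]
        exact this
      · rw [Equiv.Perm.ofSubtype_apply_of_not_mem u hx,
          Equiv.Perm.ofSubtype_apply_of_not_mem u (by rwa [hS])]
  have hC : ∀ (u : Equiv.Perm (Subtype S)) (lam del : Multiset ℕ),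
      CC lam del ε (Equiv.Perm.ofSubtype u) ↔ CC lam del (ε.subtypePerm hS) u := by
    intro u lam del
    apply CC_semi Subtype.val Subtype.val_injective
    · intro x; rw [Equiv.Perm.ofSubtype_apply_coe]
    · intro x; rfl
    · exact hg.2.1
    · intro y hy
      apply Equiv.Perm.ofSubtype_apply_of_not_mem
      simpa using hy
  have hO : Equiv.Perm.ofSubtype (ω.subtypePerm hS') = ω :=
    Equiv.Perm.ofSubtype_subtypePerm hS' hω
  have hP : ∀ p : Equiv.Perm (Subtype S) × Equiv.Perm (Subtype S),
      PP lam del beta gam (ε.subtypePerm hS) (ω.subtypePerm hS') (fun _ => True) p ↔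
      PP lam del beta gam ε ω S (Equiv.Perm.ofSubtype p.1, Equiv.Perm.ofSubtype p.2) := by
    rintro ⟨u, v⟩
    simp only [PP]
    rw [hG, hG, hC, hC, ← map_mul]
    conv_rhs => rw [← hO]
    rw [Equiv.Perm.ofSubtype_injective.eq_iff]
    refine and_congr_right fun _ => and_congr_right fun _ => and_congr_right fun _ =>
      and_congr_right fun _ => and_congr_right fun _ => ?_
    constructor
    · intro h t
      by_cases ht : S t
      · have := h ⟨t, ht⟩
        simp only [iff_true] at this
        simp only [ht, iff_true]
        rw [Equiv.Perm.ofSubtype_apply_of_mem u ht, Equiv.Perm.ofSubtype_apply_of_mem v ht]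
        simpa [Subtype.ext_iff] using this
      · simp [Equiv.Perm.ofSubtype_apply_of_not_mem _ ht, ht]
    · intro h t
      have := (h t).2 t.2
      rw [Equiv.Perm.ofSubtype_apply_coe, Equiv.Perm.ofSubtype_apply_coe] at this
      simpa [Subtype.ext_iff] using this
  symm
  refine Nat.card_congr (Equiv.ofBijective
    (fun p => ⟨(Equiv.Perm.ofSubtype p.1.1, Equiv.Perm.ofSubtype p.1.2), (hP p.1).1 p.2⟩) ⟨?_, ?_⟩)
  · rintro ⟨⟨u, v⟩, h⟩ ⟨⟨u', v'⟩, h'⟩ heq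
    simp only [Subtype.mk.injEq, Prod.mk.injEq, Equiv.Perm.ofSubtype_injective.eq_iff] at heq
    obtain ⟨rfl, rfl⟩ := heq
    rfl
  · rintro ⟨⟨u, v⟩, h⟩
    have hu : ∀ x, u x ≠ x → S x := fun x hx => (h.2.2.2.2.2 x).1 (Or.inl hx)
    have hv : ∀ x, v x ≠ x → S x := fun x hx => (h.2.2.2.2.2 x).1 (Or.inr hx)
    have gen : ∀ w : Equiv.Perm α, (∀ x, w x ≠ x → S x) → ∀ x, S (w x) ↔ S x := by
      intro w hw x
      by_cases hx : w x = x
      · rw [hx]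
      · exact iff_of_true (hw _ (fun hc => hx (w.injective hc))) (hw _ hx)
    have e1 := Equiv.Perm.ofSubtype_subtypePerm (gen u hu) hu
    have e2 := Equiv.Perm.ofSubtype_subtypePerm (gen v hv) hv
    refine ⟨⟨(u.subtypePerm (gen u hu), v.subtypePerm (gen v hv)), (hP _).2 ?_⟩, ?_⟩
    · rw [e1, e2]; exact h
    · apply Subtype.ext
      exact Prod.ext e1 e2

noncomputable def cc (lam del beta gam rho nu : Multiset ℕ) (k : ℕ) : ℕ :=
  if h : ∃ p : Equiv.Perm (Fin (2 * k)) × Equiv.Perm (Fin (2 * k)),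
      Good p.1 p.2 ∧ CC rho nu p.1 p.2 then
    FF lam del beta gam h.choose.1 h.choose.2 (fun _ => True) else 0

lemma FF_eq_cc [Fintype α] (lam del beta gam rho nu : Multiset ℕ)
    (hrho : ∀ p ∈ rho, 2 ≤ p) (hnu : ∀ p ∈ nu, 1 ≤ p) (k : ℕ)
    (hg : Good ε ω) (hc : Fintype.card α = 2 * k) (h : CC rho nu ε ω) :
    FF lam del beta gam ε ω (fun _ => True) = cc lam del beta gam rho nu k := by
  have hex : ∃ p : Equiv.Perm (Fin (2 * k)) × Equiv.Perm (Fin (2 * k)),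
      Good p.1 p.2 ∧ CC rho nu p.1 p.2 := by
    let e := Fintype.equivFinOfCardEq hc
    exact ⟨(e.permCongr ε, e.permCongr ω), (Good_permCongr e ε ω).2 hg,
      (CC_permCongr e ε ω hg.2.1 rho nu).2 h⟩
  unfold cc
  rw [dif_pos hex]
  obtain ⟨hg', h'⟩ := hex.choose_spec
  obtain ⟨e, h1, h2⟩ := exists_conj' rho nu hrho hnu hg hg' (by simp [hc]) h h'
  rw [← FF_permCongr lam del beta gam e ε ω hg.2.1]
  congr 1
  · ext x
    rw [Equiv.permCongr_apply, h2]; simp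
  · ext x
    rw [Equiv.permCongr_apply, h1]; simp

def q2 {n : ℕ} (v : Fin (2 * n)) : Fin n := ⟨v.1 / 2, by have := v.2; omega⟩

lemma eps_val {n : ℕ} (v : Fin (2 * n)) :
    (epsilonPerm n v).1 = if v.1 % 2 = 0 then v.1 + 1 else v.1 - 1 := rfl

lemma pf_val {n : ℕ} (i : Fin n) : (pairFst i).1 = 2 * i.1 := rfl

lemma ps_val {n : ℕ} (i : Fin n) : (pairSnd i).1 = 2 * i.1 + 1 := rfl

lemma eps_pf {n : ℕ} (i : Fin n) : epsilonPerm n (pairFst i) = pairSnd i := by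
  ext; rw [eps_val, pf_val, ps_val]; split_ifs <;> omega

lemma eps_ps {n : ℕ} (i : Fin n) : epsilonPerm n (pairSnd i) = pairFst i := by
  ext; rw [eps_val, pf_val, ps_val]; split_ifs <;> omega

lemma eps_eps {n : ℕ} (v : Fin (2 * n)) : epsilonPerm n (epsilonPerm n v) = v := by
  ext; rw [eps_val, eps_val]; split_ifs <;> omega

lemma eps_ne {n : ℕ} (v : Fin (2 * n)) : epsilonPerm n v ≠ v := by
  intro h
  have := congrArg Fin.val h
  rw [eps_val] at this
  split_ifs at this <;> omega

lemma pf_or {n : ℕ} (v : Fin (2 * n)) : v = pairFst (q2 v) ∨ v = pairSnd (q2 v) := by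
  rcases Nat.mod_two_eq_zero_or_one v.1 with h | h
  · left; ext; rw [pf_val]; simp only [q2]; omega
  · right; ext; rw [ps_val]; simp only [q2]; omega

lemma q2_pf {n : ℕ} (i : Fin n) : q2 (pairFst i) = i := by
  ext; simp only [q2, pf_val]; omega

lemma q2_ps {n : ℕ} (i : Fin n) : q2 (pairSnd i) = i := by
  ext; simp only [q2, ps_val]; omega

lemma q2_eps {n : ℕ} (v : Fin (2 * n)) : q2 (epsilonPerm n v) = q2 v := by
  rcases pf_or v with h | h <;> rw [h]
  · rw [eps_pf, q2_ps, q2_pf]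
  · rw [eps_ps, q2_ps, q2_pf]

lemma hyper_iff {n : ℕ} (ω : Equiv.Perm (Fin (2 * n))) :
    IsHyperoct ω ↔ Good (epsilonPerm n) ω := by
  constructor
  · intro h
    have key : ∀ i, ω (pairSnd i) = epsilonPerm n (ω (pairFst i)) := by
      intro i
      obtain ⟨j, hj⟩ := h i
      have h1 : ω (pairFst i) ∈ ({pairFst j, pairSnd j} : Set (Fin (2 * n))) := by
        rw [← hj]; simp
      have h2 : ω (pairSnd i) ∈ ({pairFst j, pairSnd j} : Set (Fin (2 * n))) := by
        rw [← hj]; simp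
      have h3 : ω (pairFst i) ≠ ω (pairSnd i) := by
        intro hc
        have := ω.injective hc
        rw [← eps_pf] at this
        exact eps_ne _ this.symm
      rcases h1 with h1 | h1 <;> rcases h2 with h2 | h2
      · exact absurd (h1.trans h2.symm) h3
      · rw [h1, h2, eps_pf]
      · rw [h1, h2, eps_ps]
      · exact absurd (h1.trans h2.symm) h3
    refine ⟨eps_eps, eps_ne, fun v => ?_⟩
    rcases pf_or v with h | h <;> rw [h]
    · rw [eps_pf, key]
    · rw [eps_ps, key, eps_eps]
  · intro hg i
    refine ⟨q2 (ω (pairFst i)), ?_⟩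
    rw [← eps_pf i, hg.2.2]
    rcases pf_or (ω (pairFst i)) with h | h
    · rw [← eps_pf, ← h]
    · have h' : pairFst (q2 (ω (pairFst i))) = epsilonPerm n (ω (pairFst i)) := by
        rw [← eps_ps, ← h]
      rw [h', ← h, Set.pair_comm]

lemma card_q2 {n : ℕ} (U : Finset (Fin n)) :
    (Finset.univ.filter (fun v : Fin (2 * n) => q2 v ∈ U)).card = 2 * U.card := by
  rw [Finset.card_eq_sum_card_fiberwise (f := q2) (t := U)]
  · rw [Finset.sum_congr rfl (g := fun _ => 2)]
    · simp [mul_comm]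
    · intro i hi
      have : (Finset.univ.filter (fun v : Fin (2 * n) => q2 v ∈ U)).filter (fun v => q2 v = i)
          = {pairFst i, pairSnd i} := by
        ext v
        simp only [Finset.mem_filter, Finset.mem_univ, true_and, Finset.mem_insert,
          Finset.mem_singleton]
        constructor
        · rintro ⟨-, rfl⟩; exact pf_or v
        · rintro (rfl | rfl)
          · rw [q2_pf]; exact ⟨hi, rfl⟩
          · rw [q2_ps]; exact ⟨hi, rfl⟩
      rw [this, Finset.card_pair]
      rw [← eps_pf]; exact (eps_ne _).symm
  · intro v hv
    simpa using hv

/-- set of moved pairs -/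
noncomputable def mv {n : ℕ} (x : Equiv.Perm (Fin (2 * n))) : Finset (Fin n) :=
  Finset.univ.filter (fun i => x (pairFst i) ≠ pairFst i)

lemma mem_mv {n : ℕ} {x : Equiv.Perm (Fin (2 * n))} (hg : Good (epsilonPerm n) x)
    (v : Fin (2 * n)) : q2 v ∈ mv x ↔ x v ≠ v := by
  simp only [mv, Finset.mem_filter, Finset.mem_univ, true_and]
  rcases pf_or v with h | h
  · rw [← h]
  · conv_rhs => rw [h, ← eps_pf, hg.2.2]
    rw [(epsilonPerm n).injective.ne_iff]

lemma card_mv {n : ℕ} {x : Equiv.Perm (Fin (2 * n))} (hg : Good (epsilonPerm n) x)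
    (lam del : Multiset ℕ)
    (hlam : ∀ p ∈ lam, 2 ≤ p) (hdel : ∀ p ∈ del, 1 ≤ p)
    (hn : lam.sum + del.sum ≤ n) (h : CC lam del (epsilonPerm n) x) :
    (mv x).card = lam.sum + del.sum := by
  have h1 := hg.fixed lam del n hlam hdel (by simp) hn h
  have h2 := card_q2 (mv x)
  simp only [mem_mv hg] at h2
  have h3 : 2 * (mv x).card = 2 * (lam.sum + del.sum) := by
    rw [← h2, ← h1]
    congr!
  omega

lemma card_supersets {n : ℕ} (U₀ : Finset (Fin n)) (k : ℕ) (hk : U₀.card ≤ k) :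
    (Finset.univ.filter (fun U : Finset (Fin n) => U₀ ⊆ U ∧ U.card = k)).card =
      (n - U₀.card).choose (k - U₀.card) := by
  have : n - U₀.card = (U₀ᶜ).card := by rw [Finset.card_compl, Fintype.card_fin]
  rw [this, ← Finset.card_powersetCard]
  apply Finset.card_nbij' (fun U => U \ U₀) (fun V => V ∪ U₀)
  · intro U hU
    simp only [Finset.coe_filter, Finset.mem_univ, true_and, Set.mem_ofPred_eq, Finset.mem_coe,
      Finset.mem_powersetCard] at hU ⊢
    refine ⟨?_, ?_⟩
    · intro i hi
      simp only [Finset.mem_sdiff, Finset.mem_compl] at hi ⊢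
      exact hi.2
    · rw [Finset.card_sdiff_of_subset hU.1, hU.2]
  · intro V hV
    simp only [Finset.coe_filter, Finset.mem_univ, true_and, Set.mem_ofPred_eq, Finset.mem_coe,
      Finset.mem_powersetCard] at hV ⊢
    refine ⟨Finset.subset_union_right, ?_⟩
    rw [Finset.card_union_of_disjoint, hV.2]
    · omega
    · rw [Finset.disjoint_left]
      intro i hi
      simpa using hV.1 hi
  · intro U hU
    simp only [Finset.coe_filter, Finset.mem_univ, true_and, Set.mem_ofPred_eq] at hU
    exact Finset.sdiff_union_of_subset hU.1
  · intro V hV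
    simp only [Finset.mem_coe, Finset.mem_powersetCard] at hV
    apply Finset.union_sdiff_cancel_right
    rw [Finset.disjoint_left]
    intro i hi
    simpa using hV.1 hi

lemma PP_mv {n : ℕ}
    {U : Finset (Fin n)} {p : Equiv.Perm (Fin (2 * n)) × Equiv.Perm (Fin (2 * n))}
    (h1 : Good (epsilonPerm n) p.1) (h2 : Good (epsilonPerm n) p.2) :
    (∀ t, (p.1 t ≠ t ∨ p.2 t ≠ t) ↔ q2 t ∈ U) ↔ mv p.1 ∪ mv p.2 = U := by
  constructor
  · intro h
    ext i
    rw [Finset.mem_union, ← q2_pf i, mem_mv h1, mem_mv h2, h]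
  · rintro rfl t
    rw [Finset.mem_union, mem_mv h1, mem_mv h2]

lemma main_count (lam del beta gam rho nu : Multiset ℕ)
    (hlam : ∀ p ∈ lam, 2 ≤ p) (hdel : ∀ p ∈ del, 1 ≤ p)
    (hbeta : ∀ p ∈ beta, 2 ≤ p) (hgam : ∀ p ∈ gam, 1 ≤ p)
    (hrho : ∀ p ∈ rho, 2 ≤ p) (hnu : ∀ p ∈ nu, 1 ≤ p)
    (n : ℕ) (hn1 : lam.sum + del.sum ≤ n) (hn2 : beta.sum + gam.sum ≤ n)
    (hn3 : rho.sum + nu.sum ≤ n) (ω₀ : Equiv.Perm (Fin (2 * n)))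
    (hg : Good (epsilonPerm n) ω₀) (hC : CC rho nu (epsilonPerm n) ω₀) :
    Nat.card {p : Equiv.Perm (Fin (2 * n)) × Equiv.Perm (Fin (2 * n)) //
      Good (epsilonPerm n) p.1 ∧ CC lam del (epsilonPerm n) p.1 ∧
      Good (epsilonPerm n) p.2 ∧ CC beta gam (epsilonPerm n) p.2 ∧ p.1 * p.2 = ω₀} =
    ∑ k ∈ Finset.Icc (rho.sum + nu.sum) (lam.sum + del.sum + beta.sum + gam.sum),
      (n - (rho.sum + nu.sum)).choose (k - (rho.sum + nu.sum)) *
        cc lam del beta gam rho nu k := by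
  set r := rho.sum + nu.sum with hr
  set L := lam.sum + del.sum + beta.sum + gam.sum with hL
  have hU₀ : (mv ω₀).card = r := card_mv hg rho nu hrho hnu hn3 hC
  have hsub : ∀ p : Equiv.Perm (Fin (2 * n)) × Equiv.Perm (Fin (2 * n)),
      p.1 * p.2 = ω₀ → mv ω₀ ⊆ mv p.1 ∪ mv p.2 := by
    intro p hp i hi
    simp only [mv, Finset.mem_union, Finset.mem_filter, Finset.mem_univ, true_and] at hi ⊢
    by_contra! hc
    apply hi
    rw [← hp, Equiv.Perm.mul_apply, hc.2, hc.1]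
  rw [Nat.card_eq_fintype_card, Fintype.card_subtype]
  rw [Finset.card_eq_sum_card_fiberwise (f := fun p => mv p.1 ∪ mv p.2)
    (t := Finset.univ.filter (fun U : Finset (Fin n) => mv ω₀ ⊆ U ∧ U.card ≤ L))]
  · rw [Finset.sum_congr rfl (g := fun U : Finset (Fin n) => cc lam del beta gam rho nu U.card)]
    · rw [← Finset.sum_fiberwise_of_maps_to (g := Finset.card) (t := Finset.Icc r L)]
      · apply Finset.sum_congr rfl
        intro k hk
        rw [Finset.mem_Icc] at hk
        rw [Finset.sum_congr rfl (g := fun _ => cc lam del beta gam rho nu k)]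
        · rw [Finset.sum_const, smul_eq_mul]
          congr 1
          rw [← hU₀, ← card_supersets (mv ω₀) k (by omega)]
          congr 1
          ext U
          simp only [Finset.mem_filter, Finset.mem_univ, true_and]
          constructor
          · rintro ⟨⟨h1, h2⟩, h3⟩; exact ⟨h1, h3⟩
          · rintro ⟨h1, h3⟩; exact ⟨⟨h1, by omega⟩, h3⟩
        · intro U hU
          rw [(Finset.mem_filter.1 hU).2]
      · intro U hU
        simp only [Finset.mem_filter, Finset.mem_univ, true_and] at hU
        rw [Finset.mem_Icc]
        refine ⟨?_, hU.2⟩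
        rw [← hU₀]
        exact Finset.card_le_card hU.1
    · intro U hU
      simp only [Finset.mem_filter, Finset.mem_univ, true_and] at hU
      have hS : ∀ x, q2 (epsilonPerm n x) ∈ U ↔ q2 x ∈ U := fun x => by rw [q2_eps]
      have hω : ∀ x, ω₀ x ≠ x → q2 x ∈ U := fun x hx => hU.1 ((mem_mv hg x).2 hx)
      have hS' : ∀ x, q2 (ω₀ x) ∈ U ↔ q2 x ∈ U := by
        intro x
        by_cases hx : ω₀ x = x
        · rw [hx]
        · exact iff_of_true (hω _ (fun hc => hx (ω₀.injective hc))) (hω _ hx)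
      have e1 := FF_restrict lam del beta gam hg (fun v => q2 v ∈ U) hS hS' hω
      have hgT : Good (Equiv.Perm.subtypePerm (p := fun v => q2 v ∈ U) (epsilonPerm n) hS) (Equiv.Perm.subtypePerm (p := fun v => q2 v ∈ U) ω₀ hS') :=
        ⟨fun x => Subtype.ext (hg.1 x), fun x hx => hg.2.1 x (congrArg Subtype.val hx),
          fun x => Subtype.ext (hg.2.2 x)⟩
      have hCT : CC rho nu (Equiv.Perm.subtypePerm (p := fun v => q2 v ∈ U) (epsilonPerm n) hS) (Equiv.Perm.subtypePerm (p := fun v => q2 v ∈ U) ω₀ hS') := by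
        refine (CC_semi Subtype.val Subtype.val_injective (fun x => rfl) (fun x => rfl)
          hg.2.1 ?_ rho nu).1 hC
        intro y hy
        by_contra hc
        exact hy ⟨⟨y, hω y hc⟩, rfl⟩
      have e2 := FF_eq_cc lam del beta gam rho nu hrho hnu U.card hgT
        (by rw [Fintype.card_subtype, ← card_q2 U]) hCT
      have e3 : FF lam del beta gam (epsilonPerm n) ω₀ (fun v => q2 v ∈ U) =
          cc lam del beta gam rho nu U.card := by
        rw [e1, ← e2]
        congr!
      rw [← e3]
      unfold FF
      rw [Nat.card_eq_fintype_card, Fintype.card_subtype, Finset.filter_filter]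
      congr 1
      ext p
      simp only [Finset.mem_filter, Finset.mem_univ, true_and]
      constructor
      · rintro ⟨⟨h1, h2, h3, h4, h5⟩, h6⟩
        exact ⟨h1, h2, h3, h4, h5, (PP_mv h1 h3).2 h6⟩
      · rintro ⟨h1, h2, h3, h4, h5, h6⟩
        exact ⟨⟨h1, h2, h3, h4, h5⟩, (PP_mv h1 h3).1 h6⟩
  · intro p hp
    simp only [Finset.coe_filter, Finset.mem_univ, true_and, Set.mem_ofPred_eq] at hp ⊢
    obtain ⟨h1, h2, h3, h4, h5⟩ := hp
    refine ⟨hsub p h5, (Finset.card_union_le _ _).trans ?_⟩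
    rw [card_mv h1 lam del hlam hdel hn1 h2, card_mv h3 beta gam hbeta hgam hn2 h4]
    omega

lemma prod_choose (n r k : ℕ) (hn : r ≤ n) :
    ∏ t ∈ Finset.Ico r k, ((n : ℚ) - (t : ℚ)) =
      ((n - r).choose (k - r) : ℚ) * ((k - r).factorial : ℚ) := by
  rw [Finset.prod_Ico_eq_prod_range]
  have h := descPochhammer_eval_eq_prod_range (R := ℚ) (k - r) ((n - r : ℕ) : ℚ)
  rw [descPochhammer_eval_eq_descFactorial, Nat.descFactorial_eq_factorial_mul_choose] at h
  rw [mul_comm, ← Nat.cast_mul, h]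
  apply Finset.prod_congr rfl
  intro i _
  push_cast [hn]
  ring

lemma first (lam del beta gam rho nu : Multiset ℕ)
    (hlam : ∀ p ∈ lam, 2 ≤ p) (hdel : ∀ p ∈ del, 1 ≤ p)
    (hbeta : ∀ p ∈ beta, 2 ≤ p) (hgam : ∀ p ∈ gam, 1 ≤ p)
    (hrho : ∀ p ∈ rho, 2 ≤ p) (hnu : ∀ p ∈ nu, 1 ≤ p) :
    (∃ b : ℕ → ℚ, (∀ j, 0 ≤ b j) ∧
      ∀ n : ℕ, lam.sum + del.sum ≤ n → beta.sum + gam.sum ≤ n → rho.sum + nu.sum ≤ n →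
        ∀ ω₀ : Equiv.Perm (Fin (2 * n)), IsHyperoct ω₀ →
          hyperTypePos n ω₀ = rho + Multiset.replicate (n - rho.sum - nu.sum) 1 →
          hyperTypeNeg n ω₀ = nu →
          (Nat.card {p : Equiv.Perm (Fin (2 * n)) × Equiv.Perm (Fin (2 * n)) //
              IsHyperoct p.1 ∧
              hyperTypePos n p.1 = lam + Multiset.replicate (n - lam.sum - del.sum) 1 ∧
              hyperTypeNeg n p.1 = del ∧
              IsHyperoct p.2 ∧
              hyperTypePos n p.2 = beta + Multiset.replicate (n - beta.sum - gam.sum) 1 ∧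
              hyperTypeNeg n p.2 = gam ∧
              p.1 * p.2 = ω₀} : ℚ) =
            ∑ k ∈ Finset.Icc (rho.sum + nu.sum)
                (lam.sum + del.sum + beta.sum + gam.sum),
              b k * ∏ t ∈ Finset.Ico (rho.sum + nu.sum) k, ((n : ℚ) - (t : ℚ))) := by
  refine ⟨fun k => (cc lam del beta gam rho nu k : ℚ) / ((k - (rho.sum + nu.sum)).factorial : ℚ),
    fun j => by positivity, ?_⟩
  intro n hn1 hn2 hn3 ω₀ hω hp hn
  rw [hyper_iff] at hω
  rw [hp_eq] at hp
  rw [hn_eq] at hn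
  have hC := (hω.type_iff rho nu n hrho hnu (by simp)).1 ⟨hp, hn⟩
  have hm := main_count lam del beta gam rho nu hlam hdel hbeta hgam hrho hnu n hn1 hn2 hn3 ω₀ hω hC
  have hcard : Nat.card {p : Equiv.Perm (Fin (2 * n)) × Equiv.Perm (Fin (2 * n)) //
              IsHyperoct p.1 ∧
              hyperTypePos n p.1 = lam + Multiset.replicate (n - lam.sum - del.sum) 1 ∧
              hyperTypeNeg n p.1 = del ∧
              IsHyperoct p.2 ∧
              hyperTypePos n p.2 = beta + Multiset.replicate (n - beta.sum - gam.sum) 1 ∧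
              hyperTypeNeg n p.2 = gam ∧
              p.1 * p.2 = ω₀} = Nat.card {p : Equiv.Perm (Fin (2 * n)) × Equiv.Perm (Fin (2 * n)) //
      Good (epsilonPerm n) p.1 ∧ CC lam del (epsilonPerm n) p.1 ∧
      Good (epsilonPerm n) p.2 ∧ CC beta gam (epsilonPerm n) p.2 ∧ p.1 * p.2 = ω₀} := by
    refine Nat.card_congr (Equiv.subtypeEquivRight ?_)
    rintro ⟨x, y⟩
    simp only [hyper_iff, hp_eq, hn_eq]
    constructor
    · rintro ⟨h1, h2, h3, h4, h5, h6, h7⟩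
      exact ⟨h1, (h1.type_iff lam del n hlam hdel (by simp)).1 ⟨h2, h3⟩, h4,
        (h4.type_iff beta gam n hbeta hgam (by simp)).1 ⟨h5, h6⟩, h7⟩
    · rintro ⟨h1, h2, h4, h5, h7⟩
      obtain ⟨a1, a2⟩ := (h1.type_iff lam del n hlam hdel (by simp)).2 h2
      obtain ⟨a3, a4⟩ := (h4.type_iff beta gam n hbeta hgam (by simp)).2 h5
      exact ⟨h1, a1, a2, h4, a3, a4, h7⟩
  rw [hcard, hm, Nat.cast_sum]
  apply Finset.sum_congr rfl
  intro k _
  rw [prod_choose n _ k hn3, Nat.cast_mul]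
  have : ((k - (rho.sum + nu.sum)).factorial : ℚ) ≠ 0 := by positivity
  field_simp

end HO

/-- Polynomiality of the structure coefficients of the center `Z(ℂ[B_n])` of the
hyperoctahedral group algebra, for proper pairs of partitions. -/
theorem stmt18 (lam del beta gam rho nu : Multiset ℕ)
    (hlam : ∀ p ∈ lam, 2 ≤ p) (hdel : ∀ p ∈ del, 1 ≤ p)
    (hbeta : ∀ p ∈ beta, 2 ≤ p) (hgam : ∀ p ∈ gam, 1 ≤ p)
    (hrho : ∀ p ∈ rho, 2 ≤ p) (hnu : ∀ p ∈ nu, 1 ≤ p) :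
    (∃ b : ℕ → ℚ, (∀ j, 0 ≤ b j) ∧
      ∀ n : ℕ, lam.sum + del.sum ≤ n → beta.sum + gam.sum ≤ n → rho.sum + nu.sum ≤ n →
        ∀ ω₀ : Equiv.Perm (Fin (2 * n)), IsHyperoct ω₀ →
          hyperTypePos n ω₀ = rho + Multiset.replicate (n - rho.sum - nu.sum) 1 →
          hyperTypeNeg n ω₀ = nu →
          (Nat.card {p : Equiv.Perm (Fin (2 * n)) × Equiv.Perm (Fin (2 * n)) //
              IsHyperoct p.1 ∧
              hyperTypePos n p.1 = lam + Multiset.replicate (n - lam.sum - del.sum) 1 ∧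
              hyperTypeNeg n p.1 = del ∧
              IsHyperoct p.2 ∧
              hyperTypePos n p.2 = beta + Multiset.replicate (n - beta.sum - gam.sum) 1 ∧
              hyperTypeNeg n p.2 = gam ∧
              p.1 * p.2 = ω₀} : ℚ) =
            ∑ k ∈ Finset.Icc (rho.sum + nu.sum)
                (lam.sum + del.sum + beta.sum + gam.sum),
              b k * ∏ t ∈ Finset.Ico (rho.sum + nu.sum) k, ((n : ℚ) - (t : ℚ))) ∧
    (∃ f : Polynomial ℚ,
      (f = 0 ∨ f.natDegree + (rho.sum + nu.sum) ≤
          lam.sum + del.sum + beta.sum + gam.sum) ∧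
      ∀ n : ℕ, lam.sum + del.sum ≤ n → beta.sum + gam.sum ≤ n → rho.sum + nu.sum ≤ n →
        ∀ ω₀ : Equiv.Perm (Fin (2 * n)), IsHyperoct ω₀ →
          hyperTypePos n ω₀ = rho + Multiset.replicate (n - rho.sum - nu.sum) 1 →
          hyperTypeNeg n ω₀ = nu →
          (Nat.card {p : Equiv.Perm (Fin (2 * n)) × Equiv.Perm (Fin (2 * n)) //
              IsHyperoct p.1 ∧
              hyperTypePos n p.1 = lam + Multiset.replicate (n - lam.sum - del.sum) 1 ∧
              hyperTypeNeg n p.1 = del ∧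
              IsHyperoct p.2 ∧
              hyperTypePos n p.2 = beta + Multiset.replicate (n - beta.sum - gam.sum) 1 ∧
              hyperTypeNeg n p.2 = gam ∧
              p.1 * p.2 = ω₀} : ℚ) = f.eval (n : ℚ)) := by
  obtain ⟨b, hb0, hb⟩ := HO.first lam del beta gam rho nu hlam hdel hbeta hgam hrho hnu
  refine ⟨⟨b, hb0, hb⟩, ?_⟩
  refine ⟨∑ k ∈ Finset.Icc (rho.sum + nu.sum) (lam.sum + del.sum + beta.sum + gam.sum),
      Polynomial.C (b k) * ∏ t ∈ Finset.Ico (rho.sum + nu.sum) k,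
        (Polynomial.X - Polynomial.C (t : ℚ)), ?_, ?_⟩
  · by_cases h : rho.sum + nu.sum ≤ lam.sum + del.sum + beta.sum + gam.sum
    · right
      rw [← Nat.le_sub_iff_add_le h]
      apply Polynomial.natDegree_sum_le_of_forall_le
      intro k hk
      rw [Finset.mem_Icc] at hk
      refine (Polynomial.natDegree_C_mul_le _ _).trans ?_
      rw [Polynomial.natDegree_prod_of_monic _ _ (fun t _ => Polynomial.monic_X_sub_C _)]
      simp only [Polynomial.natDegree_X_sub_C, Finset.sum_const, Nat.card_Ico, smul_eq_mul, mul_one]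
      omega
    · left
      rw [Finset.Icc_eq_empty h, Finset.sum_empty]
  · intro n hn1 hn2 hn3 ω₀ hω hp hn
    rw [hb n hn1 hn2 hn3 ω₀ hω hp hn, Polynomial.eval_finsetSum]
    apply Finset.sum_congr rfl
    intro k _
    rw [Polynomial.eval_mul, Polynomial.eval_C, Polynomial.eval_prod]
    simp
end

section
/- Let R be a finite associative unital ring and J a two-sided ideal of R that is nilpotent (Jᵐ = 0 for some m ≥ 1). Then G := {1 + x : x ∈ J} is a subgroup of the group of units of R, and for all x, y, z ∈ J: #{(a,b,c,d) ∈ G⁴ : a·x·b + c·y·d + (a·x·b)·(c·y·d) = z} = #{(a,b,c,d) ∈ G⁴ : a·x·b + c·y·d = z}. (This identity expresses that the natural map from the superclass algebra of G to the double-coset algebra of G×G in the semidirect product (G×G)⋉J, rescaled by 1/|G|², is an algebra morphism.) -/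
/-- For a finite ring `R` with a nilpotent two-sided ideal `J`, the set `G = 1 + J` is a
subgroup of the group of units of `R`, and the counting identity expressing that the map
from the superclass algebra of `G` to the double-coset algebra of `G × G` in
`(G × G) ⋉ J`, rescaled by `1/|G|²`, is an algebra morphism. -/
theorem stmt19 {R : Type} [Ring R] [Fintype R] (J : TwoSidedIdeal R)
    (m : ℕ) (hm : 1 ≤ m)
    (hnil : ∀ f : Fin m → R, (∀ i, f i ∈ J) → (List.ofFn f).prod = 0) :
    ((∀ x ∈ J, IsUnit (1 + x)) ∧
      ∃ H : Subgroup Rˣ, (H : Set Rˣ) = {u : Rˣ | (u : R) - 1 ∈ J}) ∧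
    ∀ x ∈ J, ∀ y ∈ J, ∀ z ∈ J,
      Nat.card {q : R × R × R × R //
          q.1 - 1 ∈ J ∧ q.2.1 - 1 ∈ J ∧ q.2.2.1 - 1 ∈ J ∧ q.2.2.2 - 1 ∈ J ∧
          q.1 * x * q.2.1 + q.2.2.1 * y * q.2.2.2 +
            (q.1 * x * q.2.1) * (q.2.2.1 * y * q.2.2.2) = z} =
        Nat.card {q : R × R × R × R //
          q.1 - 1 ∈ J ∧ q.2.1 - 1 ∈ J ∧ q.2.2.1 - 1 ∈ J ∧ q.2.2.2 - 1 ∈ J ∧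
          q.1 * x * q.2.1 + q.2.2.1 * y * q.2.2.2 = z} := by
  have hU : ∀ x ∈ J, IsUnit (1 + x) := by
    intro x hx
    apply IsNilpotent.isUnit_one_add
    refine ⟨m, ?_⟩
    have h := hnil (fun _ => x) (fun _ => hx)
    simpa [List.ofFn_const] using h
  have hmul : ∀ u v : R, u - 1 ∈ J → v - 1 ∈ J → u * v - 1 ∈ J := by
    intro u v hu hv
    have e : u * v - 1 = (u - 1) * v + (v - 1) := by noncomm_ring
    rw [e]
    exact J.add_mem (J.mul_mem_right _ _ hu) hv
  have hinv : ∀ u v : R, u - 1 ∈ J → v * u = 1 → v - 1 ∈ J := by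
    intro u v hu h
    have e : v - 1 = - (v * (u - 1)) := by rw [mul_sub, h]; noncomm_ring
    rw [e]
    exact J.neg_mem (J.mul_mem_left _ _ hu)
  refine ⟨⟨hU, ⟨{ carrier := {u : Rˣ | (u : R) - 1 ∈ J}
                  mul_mem' := ?_
                  one_mem' := ?_
                  inv_mem' := ?_ }, rfl⟩⟩, ?_⟩
  · intro u v hu hv
    simpa using hmul u v hu hv
  · simpa using J.zero_mem
  · intro u hu
    exact hinv u _ hu (by simp)
  intro x hx y hy z hz
  have hax : ∀ a b : R, a * x * b ∈ J := fun a b =>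
    J.mul_mem_right _ _ (J.mul_mem_left _ _ hx)
  have hw : ∀ a b : R, (1 + a * x * b) - 1 ∈ J := fun a b => by simpa using hax a b
  have h1 : ∀ a b : R, Ring.inverse (1 + a * x * b) * (1 + a * x * b) = 1 := fun a b =>
    Ring.inverse_mul_cancel _ (hU _ (hax a b))
  have h2 : ∀ a b : R, (1 + a * x * b) * Ring.inverse (1 + a * x * b) = 1 := fun a b =>
    Ring.mul_inverse_cancel _ (hU _ (hax a b))
  refine Nat.card_congr
    { toFun := fun q => ⟨(q.1.1, q.1.2.1, (1 + q.1.1 * x * q.1.2.1) * q.1.2.2.1, q.1.2.2.2), ?_⟩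
      invFun := fun q =>
        ⟨(q.1.1, q.1.2.1, Ring.inverse (1 + q.1.1 * x * q.1.2.1) * q.1.2.2.1, q.1.2.2.2), ?_⟩
      left_inv := ?_
      right_inv := ?_ }
  · obtain ⟨⟨a, b, c, d⟩, ha, hb, hc, hd, he⟩ := q
    refine ⟨ha, hb, hmul _ _ (hw a b) hc, hd, ?_⟩
    dsimp only at he ⊢
    rw [← he]
    noncomm_ring
  · obtain ⟨⟨a, b, c, d⟩, ha, hb, hc, hd, he⟩ := q
    refine ⟨ha, hb, hmul _ _ (hinv _ _ (hw a b) (h1 a b)) hc, hd, ?_⟩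
    dsimp only at he ⊢
    have e : ∀ t : R, a * x * b + t * c * y * d + a * x * b * (t * c * y * d)
        = a * x * b + ((1 + a * x * b) * t) * c * y * d := by
      intro t; noncomm_ring
    rw [e, h2, one_mul, he]
  · rintro ⟨⟨a, b, c, d⟩, h⟩
    simp [← mul_assoc, h1]
  · rintro ⟨⟨a, b, c, d⟩, h⟩
    simp [← mul_assoc, h2]
end
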